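/- arXiv:2205.00972 — 3 statements merged into one kernel-verified Lean document; each statement's English description precedes it below -/
import Mathlib

section
/- Unconditionally, uniformly for 1/2 ≤ σ ≤ 2 and T ≥ 2, one has ∫_{−T}^{T} |L(σ+it, χ)| / |σ+it| dt ≪ (log T)², with implied constant depending only on q. -/
open Complex

/-- The tail `∑_{n ≥ M} (n + u)^{-s}` of the Hurwitz zeta series. -/
noncomputable def hurwitzTail (M : ℕ) (s : ℂ) (u : ℝ) : ℂ :=
  ∑' m : ℕ, ((m + M + u : ℝ) : ℂ) ^ (-s)

/-- The tail `∑_{n ≥ M} ((n + u)^{-s} - n^{-s})`, which converges for `0 < Re s`. -/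
noncomputable def hurwitzTailDiff (M : ℕ) (s : ℂ) (u : ℝ) : ℂ :=
  ∑' m : ℕ, (((m + M + u : ℝ) : ℂ) ^ (-s) - ((m + M : ℝ) : ℂ) ^ (-s))

lemma summable_add_half_rpow {σ : ℝ} (hσ : 1 < σ) :
    Summable fun m : ℕ => (m + 1 / 2 : ℝ) ^ (-σ) := by
  refine ((Real.summable_one_div_nat_add_rpow (1 / 2) σ).2 hσ).congr fun m => ?_
  rw [abs_of_pos (by positivity), Real.rpow_neg (by positivity), one_div]

lemma norm_ofReal_cpow_neg_le {x y : ℝ} {s : ℂ} (hx : 0 < x) (hxy : x ≤ y) (hs : 0 ≤ s.re) :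
    ‖(y : ℂ) ^ (-s)‖ ≤ x ^ (-s.re) := by
  rw [norm_cpow_eq_rpow_re_of_pos (hx.trans_le hxy), neg_re]
  exact Real.rpow_le_rpow_of_nonpos hx hxy (by linarith)

lemma hasDerivAt_add_ofReal_cpow_neg (a : ℝ) (s : ℂ) {u : ℝ} (h : 0 < a + u) :
    HasDerivAt (fun v : ℝ => ((a + v : ℝ) : ℂ) ^ (-s)) (-s * ((a + u : ℝ) : ℂ) ^ (-(s + 1))) u := by
  have h1 : HasDerivAt (fun w : ℂ => a + w) 1 (u : ℂ) := (hasDerivAt_id _).const_add _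
  have h2 := (h1.cpow_const (c := -s) (Or.inl (by exact_mod_cast h))).comp_ofReal
  simp only [ofReal_add]
  convert! h2 using 1
  rw [mul_one, neg_add']

lemma summable_and_hasDerivAt_hurwitzTailDiff {M : ℕ} (hM : 1 ≤ M) {s : ℂ} (hs : 0 < s.re)
    {u : ℝ} (hu : u ∈ Set.Ioo (-1 / 2 : ℝ) 2) :
    (Summable fun m : ℕ => ((m + M + u : ℝ) : ℂ) ^ (-s) - ((m + M : ℝ) : ℂ) ^ (-s)) ∧
      HasDerivAt (hurwitzTailDiff M s) (-s * hurwitzTail M (s + 1) u) u := by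
  have hM' : (1 : ℝ) ≤ M := by exact_mod_cast hM
  have hd : ∀ (m : ℕ) (v : ℝ), v ∈ Set.Ioo (-1 / 2 : ℝ) 2 →
      HasDerivAt (fun v : ℝ => ((m + M + v : ℝ) : ℂ) ^ (-s) - ((m + M : ℝ) : ℂ) ^ (-s))
        (-s * ((m + M + v : ℝ) : ℂ) ^ (-(s + 1))) v := fun m v hv =>
    (hasDerivAt_add_ofReal_cpow_neg _ s (by
      have := hv.1; have : (0 : ℝ) ≤ m := m.cast_nonneg; linarith)).sub_const _
  have hb : ∀ (m : ℕ) (v : ℝ), v ∈ Set.Ioo (-1 / 2 : ℝ) 2 →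
      ‖-s * ((m + M + v : ℝ) : ℂ) ^ (-(s + 1))‖ ≤ ‖s‖ * (m + 1 / 2 : ℝ) ^ (-(s + 1).re) := by
    intro m v hv
    rw [norm_mul, norm_neg]
    gcongr
    exact norm_ofReal_cpow_neg_le (by positivity) (by linarith [hv.1]) (by simp; linarith)
  have hsum : Summable fun m : ℕ => ‖s‖ * (m + 1 / 2 : ℝ) ^ (-(s + 1).re) :=
    (summable_add_half_rpow (by simpa using hs)).mul_left _
  have h0 : (0 : ℝ) ∈ Set.Ioo (-1 / 2 : ℝ) 2 := by norm_num
  have hsum0 : Summable fun m : ℕ =>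
      ((m + M + (0 : ℝ) : ℝ) : ℂ) ^ (-s) - ((m + M : ℝ) : ℂ) ^ (-s) := by
    simp
  let g (m : ℕ) (v : ℝ) : ℂ := ((m + M + v : ℝ) : ℂ) ^ (-s) - ((m + M : ℝ) : ℂ) ^ (-s)
  let g' (m : ℕ) (v : ℝ) : ℂ := -s * ((m + M + v : ℝ) : ℂ) ^ (-(s + 1))
  refine ⟨summable_of_summable_hasDerivAt_of_isPreconnected (g := g) (g' := g') hsum isOpen_Ioo
    isPreconnected_Ioo hd hb h0 hsum0 hu, ?_⟩
  have := hasDerivAt_tsum_of_isPreconnected (g := g) (g' := g') hsum isOpen_Ioo isPreconnected_Ioo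
    hd hb h0 hsum0 hu
  rwa [tsum_mul_left] at this

lemma hurwitzTailDiff_zero (M : ℕ) (s : ℂ) : hurwitzTailDiff M s 0 = 0 := by
  simp [hurwitzTailDiff]

lemma tendsto_nat_add_cpow_neg (M : ℕ) {s : ℂ} (hs : 0 < s.re) :
    Filter.Tendsto (fun m : ℕ => ((m + M : ℝ) : ℂ) ^ (-s)) Filter.atTop (nhds 0) := by
  rw [tendsto_zero_iff_norm_tendsto_zero]
  have h1 : Filter.Tendsto (fun m : ℕ => (m + M : ℝ)) Filter.atTop Filter.atTop :=
    Filter.tendsto_atTop_add_const_right _ _ tendsto_natCast_atTop_atTop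
  refine ((tendsto_rpow_neg_atTop hs).comp h1).congr' ?_
  filter_upwards [Filter.eventually_gt_atTop 0] with m hm
  have : (0 : ℝ) < m := by exact_mod_cast hm
  simp only [Function.comp]
  rw [norm_cpow_eq_rpow_re_of_pos (by positivity), neg_re]

lemma hurwitzTailDiff_one {M : ℕ} (hM : 1 ≤ M) {s : ℂ} (hs : 0 < s.re) :
    hurwitzTailDiff M s 1 = -(M : ℂ) ^ (-s) := by
  have h := (summable_and_hasDerivAt_hurwitzTailDiff hM hs (u := 1) (by norm_num)).1.hasSum
  refine tendsto_nhds_unique h.tendsto_sum_nat ?_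
  have h2 : ∀ n : ℕ, ∑ m ∈ Finset.range n,
      (((m + M + 1 : ℝ) : ℂ) ^ (-s) - ((m + M : ℝ) : ℂ) ^ (-s)) =
      ((n + M : ℝ) : ℂ) ^ (-s) - (M : ℂ) ^ (-s) := by
    intro n
    have := Finset.sum_range_sub (fun m : ℕ => ((m + M : ℝ) : ℂ) ^ (-s)) n
    simp only [Nat.cast_add, Nat.cast_one, Nat.cast_zero, zero_add, ofReal_natCast] at this
    rw [← this]
    refine Finset.sum_congr rfl fun m _ => ?_
    rw [add_right_comm]
  simp_rw [h2]
  simpa using (tendsto_nat_add_cpow_neg M hs).sub_const ((M : ℂ) ^ (-s))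

lemma norm_hurwitzTailDiff_sub_le {M : ℕ} (hM : 1 ≤ M) {s : ℂ} (hs : 0 < s.re) {B : ℝ}
    (hB : ∀ u ∈ Set.Icc (0 : ℝ) 1, ‖hurwitzTail M (s + 1) u‖ ≤ B) {u v : ℝ}
    (hu : u ∈ Set.Icc (0 : ℝ) 1) (hv : v ∈ Set.Icc (0 : ℝ) 1) :
    ‖hurwitzTailDiff M s v - hurwitzTailDiff M s u‖ ≤ ‖s‖ * B := by
  have hB0 : 0 ≤ B := (norm_nonneg _).trans (hB u hu)
  have := (convex_Icc (0 : ℝ) 1).norm_image_sub_le_of_norm_hasDerivWithin_le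
    (f := hurwitzTailDiff M s) (f' := fun w => -s * hurwitzTail M (s + 1) w) (C := ‖s‖ * B)
    (fun w hw => (summable_and_hasDerivAt_hurwitzTailDiff hM hs
      ⟨by linarith [hw.1], by linarith [hw.2]⟩).2.hasDerivWithinAt)
    (fun w hw => by
      rw [norm_mul, norm_neg]
      gcongr
      exact hB w hw) hu hv
  refine this.trans (mul_le_of_le_one_right (by positivity) ?_)
  rw [Real.norm_eq_abs, abs_le]
  constructor <;> linarith [hu.1, hu.2, hv.1, hv.2]

lemma summable_norm_nat_add_cpow_neg {M : ℕ} (hM : 1 ≤ M) {s : ℂ} (hs : 1 < s.re) {u : ℝ}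
    (hu : 0 ≤ u) : Summable fun m : ℕ => ‖((m + M + u : ℝ) : ℂ) ^ (-s)‖ := by
  have hM' : (1 : ℝ) ≤ M := by exact_mod_cast hM
  exact (summable_add_half_rpow hs).of_nonneg_of_le (fun _ => norm_nonneg _) fun m =>
    norm_ofReal_cpow_neg_le (by positivity) (by linarith) (by linarith)

lemma hurwitzTailDiff_sub {M : ℕ} (hM : 1 ≤ M) {s : ℂ} (hs : 1 < s.re) {u v : ℝ}
    (hu : 0 ≤ u) (hv : 0 ≤ v) :
    hurwitzTailDiff M s v - hurwitzTailDiff M s u = hurwitzTail M s v - hurwitzTail M s u := by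
  have h0 := (summable_norm_nat_add_cpow_neg hM hs le_rfl).of_norm
  simp only [add_zero] at h0
  have hu' := (summable_norm_nat_add_cpow_neg hM hs hu).of_norm
  have hv' := (summable_norm_nat_add_cpow_neg hM hs hv).of_norm
  rw [hurwitzTailDiff, hurwitzTailDiff, hv'.tsum_sub h0, hu'.tsum_sub h0, hurwitzTail, hurwitzTail]
  ring

/-- A bound for the Hurwitz tails at `s + 2` propagates to `s + 1`: the mean of
`hurwitzTail M (s + 1)` over `[0, 1]` is `M ^ (-s) / s`, and its oscillation is controlled by
`hurwitzTail M (s + 2)`. -/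
lemma norm_hurwitzTail_le_of_succ {M : ℕ} (hM : 1 ≤ M) {s : ℂ} (hs : 0 < s.re) {B : ℝ}
    (hB : ∀ u ∈ Set.Icc (0 : ℝ) 1, ‖hurwitzTail M (s + 1 + 1) u‖ ≤ B) {v : ℝ}
    (hv : v ∈ Set.Icc (0 : ℝ) 1) :
    ‖hurwitzTail M (s + 1) v‖ ≤ (M : ℝ) ^ (-s.re) / ‖s‖ + ‖s + 1‖ * B := by
  have hM' : (0 : ℝ) < M := by exact_mod_cast hM
  have hs0 : s ≠ 0 := by rintro rfl; simp at hs
  have hs1 : 1 < (s + 1).re := by simpa using hs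
  have hd : ∀ w ∈ Set.Icc (0 : ℝ) 1, HasDerivWithinAt
      (fun w : ℝ => hurwitzTailDiff M s w + s * hurwitzTail M (s + 1) v * w)
      (-s * hurwitzTail M (s + 1) w + s * hurwitzTail M (s + 1) v) (Set.Icc 0 1) w := by
    intro w hw
    have h1 := (summable_and_hasDerivAt_hurwitzTailDiff hM hs (u := w)
      ⟨by linarith [hw.1], by linarith [hw.2]⟩).2
    have h2 : HasDerivAt (fun w : ℝ => s * hurwitzTail M (s + 1) v * (w : ℂ))
        (s * hurwitzTail M (s + 1) v) w := by
      simpa using ((hasDerivAt_id w).ofReal_comp).const_mul (s * hurwitzTail M (s + 1) v)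
    exact (h1.add h2).hasDerivWithinAt
  have h := (convex_Icc (0 : ℝ) 1).norm_image_sub_le_of_norm_hasDerivWithin_le hd
    (C := ‖s‖ * (‖s + 1‖ * B)) (fun w hw => by
      have : -s * hurwitzTail M (s + 1) w + s * hurwitzTail M (s + 1) v =
        s * (hurwitzTail M (s + 1) v - hurwitzTail M (s + 1) w) := by ring
      rw [this, norm_mul, ← hurwitzTailDiff_sub hM hs1 hw.1 hv.1]
      gcongr
      exact norm_hurwitzTailDiff_sub_le hM (by linarith) hB hw hv)
    (x := 0) (y := 1) (by simp) (by simp)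
  rw [hurwitzTailDiff_one hM hs, hurwitzTailDiff_zero] at h
  simp only [ofReal_one, ofReal_zero, mul_one, mul_zero, add_zero, sub_zero, norm_one] at h
  have hn : ‖(M : ℂ) ^ (-s)‖ = (M : ℝ) ^ (-s.re) := by
    rw [← ofReal_natCast, norm_cpow_eq_rpow_re_of_pos hM', neg_re]
  have h3 : ‖s‖ * ‖hurwitzTail M (s + 1) v‖ ≤ (M : ℝ) ^ (-s.re) + ‖s‖ * (‖s + 1‖ * B) := by
    rw [← norm_mul, ← hn]
    calc _ = ‖(M : ℂ) ^ (-s) + (-(M : ℂ) ^ (-s) + s * hurwitzTail M (s + 1) v)‖ := by congr 1; ring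
      _ ≤ _ := (norm_add_le _ _).trans (by gcongr)
  have hs' : 0 < ‖s‖ := norm_pos_iff.2 hs0
  rw [div_add' _ _ _ hs'.ne', le_div_iff₀ hs']
  linarith

lemma norm_hurwitzTail_le_trivial {M : ℕ} (hM : 1 ≤ M) {s : ℂ} (hs : 3 / 2 ≤ s.re) {u : ℝ}
    (hu : 0 ≤ u) :
    ‖hurwitzTail M s u‖ ≤
      (M : ℝ) ^ (-s.re) * ((M : ℝ) ^ 2 * ∑' m : ℕ, (m + 1 / 2 : ℝ) ^ (-(3 / 2) : ℝ)) := by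
  have hM' : (1 : ℝ) ≤ M := by exact_mod_cast hM
  have hsum := summable_add_half_rpow (σ := 3 / 2) (by norm_num)
  rw [hurwitzTail, ← mul_assoc, ← tsum_mul_left]
  refine tsum_of_norm_bounded (hsum.mul_left _).hasSum fun m => ?_
  have h1 := norm_ofReal_cpow_neg_le (x := m + M) (y := m + M + u) (s := s) (by positivity)
    (by linarith) (by linarith)
  refine h1.trans ?_
  have hpos : (0 : ℝ) < m + M := by positivity
  have h2 : ((m + M : ℝ)) ^ (-s.re) ≤ (m + M : ℝ) ^ (-(3 / 2) : ℝ) * (M : ℝ) ^ (-(s.re - 3 / 2)) := by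
    rw [show -s.re = -(3 / 2) + -(s.re - 3 / 2) by ring, Real.rpow_add hpos]
    gcongr ?_ * ?_
    exact Real.rpow_le_rpow_of_nonpos (by positivity) (by linarith [m.cast_nonneg (α := ℝ)])
      (by linarith)
  have h3 : (m + M : ℝ) ^ (-(3 / 2) : ℝ) ≤ (m + 1 / 2 : ℝ) ^ (-(3 / 2) : ℝ) :=
    Real.rpow_le_rpow_of_nonpos (by positivity) (by linarith) (by norm_num)
  have h4 : (M : ℝ) ^ (-(s.re - 3 / 2)) ≤ (M : ℝ) ^ (-s.re) * (M : ℝ) ^ 2 := by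
    rw [← Real.rpow_natCast, ← Real.rpow_add (by positivity)]
    exact Real.rpow_le_rpow_of_exponent_le hM' (by push_cast; linarith)
  calc _ ≤ _ := h2
    _ ≤ (m + 1 / 2 : ℝ) ^ (-(3 / 2) : ℝ) * ((M : ℝ) ^ (-s.re) * (M : ℝ) ^ 2) := by gcongr
    _ = _ := by ring

lemma norm_hurwitzTail_le_iterate {M : ℕ} (hM : 1 ≤ M) (K : ℕ) {τ : ℝ} (hτ : 0 < τ) :
    ∀ {s : ℂ}, 1 / 2 ≤ s.re → τ ≤ |s.im| → 2 * (‖s‖ + (K + 1)) ≤ M → ∀ {u : ℝ},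
      u ∈ Set.Icc (0 : ℝ) 1 → ‖hurwitzTail M (s + 1) u‖ ≤ (M : ℝ) ^ (-(s.re + 1)) *
        (2 * (M / τ) + (M : ℝ) ^ 2 * (∑' m : ℕ, (m + 1 / 2 : ℝ) ^ (-(3 / 2) : ℝ)) / 2 ^ K) := by
  have hM' : (0 : ℝ) < M := by exact_mod_cast hM
  set Z := ∑' m : ℕ, (m + 1 / 2 : ℝ) ^ (-(3 / 2) : ℝ)
  induction K with
  | zero =>
    intro s hs _ _ u hu
    refine (norm_hurwitzTail_le_trivial hM (s := s + 1) (by simp; linarith) hu.1).trans ?_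
    rw [add_re, one_re, pow_zero, div_one]
    gcongr
    linarith [show (0 : ℝ) ≤ 2 * (M / τ) by positivity]
  | succ K ih =>
    intro s hs hτs hK u hu
    push_cast at hK
    have hs1 : ‖s + 1‖ ≤ ‖s‖ + 1 := (norm_add_le _ _).trans (by simp)
    have h := norm_hurwitzTail_le_of_succ hM (s := s) (by linarith)
      (fun w hw => ih (s := s + 1) (by simp; linarith) (by simpa using hτs) (by linarith) hw) hu
    refine h.trans ?_
    rw [add_re, one_re, neg_add _ (1 : ℝ), neg_add _ (1 : ℝ),
      Real.rpow_add hM', Real.rpow_add hM', Real.rpow_neg_one]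
    have hle : τ ≤ ‖s‖ := hτs.trans (abs_im_le_norm s)
    have hs2 : ‖s + 1‖ ≤ M / 2 := by
      have : (0 : ℝ) ≤ K := K.cast_nonneg
      linarith
    have hZ : 0 ≤ Z := tsum_nonneg fun m => by positivity
    calc _ ≤ (M : ℝ) ^ (-s.re) / τ + M / 2 * ((M : ℝ) ^ (-s.re) * (M : ℝ)⁻¹ * (M : ℝ)⁻¹ *
          (2 * (M / τ) + (M : ℝ) ^ 2 * Z / 2 ^ K)) := by gcongr
      _ = _ := by field_simp; ring

lemma differentiableOn_hurwitzTailDiff {M : ℕ} (hM : 1 ≤ M) {u : ℝ} (hu : u ∈ Set.Icc (0 : ℝ) 1) :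
    DifferentiableOn ℂ (fun s => hurwitzTailDiff M s u) {s | 0 < s.re} := by
  have hM' : (1 : ℝ) ≤ M := by exact_mod_cast hM
  intro s₀ hs₀
  change 0 < s₀.re at hs₀
  set δ := s₀.re / 2
  have hδ : 0 < δ := by positivity
  let U : Set ℂ := {s | δ < s.re} ∩ Metric.ball 0 (‖s₀‖ + 1)
  have hU : IsOpen U := (isOpen_lt continuous_const continuous_re).inter Metric.isOpen_ball
  have hsU : s₀ ∈ U := ⟨by simp [δ]; linarith, by simp⟩
  have hsum : Summable fun m : ℕ => (‖s₀‖ + 1) * (m + 1 / 2 : ℝ) ^ (-(δ + 1)) :=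
    (summable_add_half_rpow (by linarith)).mul_left _
  refine ((differentiableOn_tsum_of_summable_norm (U := U) hsum (fun m => ?_) hU
    fun m s hs => ?_).differentiableAt (hU.mem_nhds hsU)).differentiableWithinAt
  · have h1 : ((m + M + u : ℝ) : ℂ) ≠ 0 := by
      rw [ofReal_ne_zero]; have := hu.1; positivity
    have h2 : ((m + M : ℝ) : ℂ) ≠ 0 := by rw [ofReal_ne_zero]; positivity
    exact (((differentiable_id.neg).const_cpow (Or.inl h1)).sub
      ((differentiable_id.neg).const_cpow (Or.inl h2))).differentiableOn
  · have hsδ : δ < s.re := hs.1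
    have hsn : ‖s‖ ≤ ‖s₀‖ + 1 := (mem_ball_zero_iff.1 hs.2).le
    have := (convex_Icc (0 : ℝ) 1).norm_image_sub_le_of_norm_hasDerivWithin_le
      (f := fun v : ℝ => ((m + M + v : ℝ) : ℂ) ^ (-s))
      (f' := fun v => -s * ((m + M + v : ℝ) : ℂ) ^ (-(s + 1)))
      (C := (‖s₀‖ + 1) * (m + 1 / 2 : ℝ) ^ (-(δ + 1)))
      (fun v hv => (hasDerivAt_add_ofReal_cpow_neg _ s
        (by have := hv.1; positivity)).hasDerivWithinAt)
      (fun v hv => by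
        have hv0 := hv.1
        have hm : (0 : ℝ) ≤ m := m.cast_nonneg
        rw [norm_mul, norm_neg, norm_cpow_eq_rpow_re_of_pos (by positivity), neg_re, add_re, one_re]
        gcongr
        calc ((m : ℝ) + M + v) ^ (-(s.re + 1)) ≤ ((m : ℝ) + M + v) ^ (-(δ + 1)) :=
              Real.rpow_le_rpow_of_exponent_le (by linarith) (by linarith)
          _ ≤ _ := Real.rpow_le_rpow_of_nonpos (by positivity) (by linarith) (by linarith))
      (x := 0) (y := u) (by simp) hu
    simp only [add_zero, sub_zero] at this
    refine this.trans (mul_le_of_le_one_right (by positivity) ?_)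
    rw [Real.norm_eq_abs, abs_of_nonneg hu.1]
    exact hu.2

lemma sum_range_mul_add {E : Type*} [AddCommMonoid E] (f : ℕ → E) (q M K : ℕ) :
    ∑ n ∈ Finset.range (q * (M + K)), f n = ∑ n ∈ Finset.range (q * M), f n +
      ∑ m ∈ Finset.range K, ∑ r ∈ Finset.range q, f (q * (m + M) + r) := by
  induction K with
  | zero => simp
  | succ K ih =>
    rw [← add_assoc, mul_add_one, Finset.sum_range_add, ih, Finset.sum_range_succ, add_assoc,
      add_comm M K]

section DirichletCharacter

variable {q : ℕ} [NeZero q]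

lemma sum_range_dirichletCharacter_succ {χ : DirichletCharacter ℂ q} (hχ : χ ≠ 1) :
    ∑ r ∈ Finset.range q, χ ((r + 1 : ℕ) : ZMod q) = 0 := by
  have h0 : ∑ r ∈ Finset.range q, χ ((r : ℕ) : ZMod q) = 0 := by
    rw [← MulChar.sum_eq_zero_of_ne_one hχ]
    refine Finset.sum_bij' (fun r _ => (r : ZMod q)) (fun a _ => a.val) (fun _ _ => by simp)
      (fun a _ => by simpa using ZMod.val_lt a)
      (fun r hr => ZMod.val_cast_of_lt (Finset.mem_range.1 hr)) (fun a _ => by simp)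
      (fun _ _ => rfl)
  have h1 := Finset.sum_range_succ (fun r : ℕ => χ (r : ZMod q)) q
  rw [Finset.sum_range_succ', h0] at h1
  simpa using h1

lemma dirichletCharacter_LFunction_eq_of_one_lt_re {χ : DirichletCharacter ℂ q} (hχ : χ ≠ 1)
    {M : ℕ} (hM : 1 ≤ M) {s : ℂ} (hs : 1 < s.re) :
    DirichletCharacter.LFunction χ s =
      ∑ n ∈ Finset.range (q * M), χ ((n + 1 : ℕ) : ZMod q) * ((n + 1 : ℕ) : ℂ) ^ (-s) +
        (q : ℂ) ^ (-s) * ∑ r ∈ Finset.range q,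
          χ ((r + 1 : ℕ) : ZMod q) * hurwitzTailDiff M s ((r + 1 : ℕ) / q) := by
  have hq : (0 : ℝ) < q := by exact_mod_cast NeZero.pos q
  set a : ℕ → ℂ := fun n => χ ((n + 1 : ℕ) : ZMod q) * ((n + 1 : ℕ) : ℂ) ^ (-s) with ha
  have hL : Filter.Tendsto (fun N => ∑ n ∈ Finset.range N, a n) Filter.atTop
      (nhds (DirichletCharacter.LFunction χ s)) := by
    rw [DirichletCharacter.LFunction_eq_LSeries χ hs]
    have h := ((ZMod.LSeriesSummable_of_one_lt_re χ hs).hasSum.tendsto_sum_nat).comp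
      (Filter.tendsto_add_atTop_nat 1)
    refine h.congr fun N => ?_
    simp only [Function.comp]
    rw [Finset.sum_range_succ', LSeries.term_zero, add_zero]
    refine Finset.sum_congr rfl fun n _ => ?_
    rw [LSeries.term_of_ne_zero n.succ_ne_zero, div_eq_mul_inv, ← cpow_neg]
  have hsub : Filter.Tendsto (fun K => q * (M + K)) Filter.atTop Filter.atTop := by
    refine Filter.tendsto_atTop_mono (fun K => ?_) Filter.tendsto_id
    exact (Nat.le_add_left K M).trans (Nat.le_mul_of_pos_left _ (NeZero.pos q))
  refine tendsto_nhds_unique (hL.comp hsub) ?_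
  have hblock : ∀ m : ℕ, ∑ r ∈ Finset.range q, a (q * (m + M) + r) =
      (q : ℂ) ^ (-s) * ∑ r ∈ Finset.range q, χ ((r + 1 : ℕ) : ZMod q) *
        (((m + M + ((r + 1 : ℕ) / q : ℝ) : ℝ) : ℂ) ^ (-s) - ((m + M : ℝ) : ℂ) ^ (-s)) := by
    intro m
    simp_rw [mul_sub, Finset.sum_sub_distrib, ← Finset.sum_mul]
    rw [sum_range_dirichletCharacter_succ hχ, zero_mul, sub_zero, Finset.mul_sum]
    refine Finset.sum_congr rfl fun r _ => ?_
    have h1 : ((q * (m + M) + r + 1 : ℕ) : ZMod q) = ((r + 1 : ℕ) : ZMod q) := by simp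
    have h2 : ((q * (m + M) + r + 1 : ℕ) : ℂ) =
        ((q : ℝ) : ℂ) * ((m + M + ((r + 1 : ℕ) / q : ℝ) : ℝ) : ℂ) := by
      rw [← ofReal_mul, ← ofReal_natCast]
      congr 1
      push_cast
      field_simp
      ring
    simp only [ha]
    rw [h1, h2, mul_cpow_ofReal_nonneg hq.le (by positivity), ofReal_natCast]
    ring
  simp_rw [Function.comp_def, sum_range_mul_add, hblock, ← Finset.mul_sum]
  refine tendsto_const_nhds.add (Filter.Tendsto.const_mul _ ?_)
  simp_rw [Finset.sum_comm (s := Finset.range _) (t := Finset.range q), ← Finset.mul_sum]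
  refine tendsto_finsetSum _ fun r hr => Filter.Tendsto.const_mul _ ?_
  have hr' : (r : ℝ) + 1 ≤ q := by exact_mod_cast Finset.mem_range.1 hr
  have hr1 : ((r + 1 : ℕ) / q : ℝ) ≤ 1 := (div_le_one hq).2 (by push_cast; exact hr')
  have hr0 : (0 : ℝ) ≤ ((r + 1 : ℕ) / q : ℝ) := by positivity
  exact (summable_and_hasDerivAt_hurwitzTailDiff hM (by linarith)
    ⟨by linarith, by linarith⟩).1.hasSum.tendsto_sum_nat

lemma succ_div_mem_Icc {r : ℕ} (hr : r ∈ Finset.range q) :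
    ((r + 1 : ℕ) / q : ℝ) ∈ Set.Icc (0 : ℝ) 1 := by
  have hq : (0 : ℝ) < q := by exact_mod_cast NeZero.pos q
  exact ⟨by positivity, (div_le_one hq).2 (by exact_mod_cast Finset.mem_range.1 hr)⟩

/-- Truncation of the Dirichlet series of a non-principal character, valid for `0 < Re s`. -/
lemma dirichletCharacter_LFunction_eq_sum_add_tail {χ : DirichletCharacter ℂ q} (hχ : χ ≠ 1)
    {M : ℕ} (hM : 1 ≤ M) {s : ℂ} (hs : 0 < s.re) :
    DirichletCharacter.LFunction χ s =
      ∑ n ∈ Finset.range (q * M), χ ((n + 1 : ℕ) : ZMod q) * ((n + 1 : ℕ) : ℂ) ^ (-s) +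
        (q : ℂ) ^ (-s) * ∑ r ∈ Finset.range q,
          χ ((r + 1 : ℕ) : ZMod q) * hurwitzTailDiff M s ((r + 1 : ℕ) / q) := by
  have hopen : IsOpen {s : ℂ | 0 < s.re} := isOpen_lt continuous_const continuous_re
  have hcpow : ∀ n : ℕ, n ≠ 0 → Differentiable ℂ fun s : ℂ => (n : ℂ) ^ (-s) := fun n hn =>
    differentiable_id.neg.const_cpow (Or.inl (by exact_mod_cast hn))
  have hrhs : DifferentiableOn ℂ (fun s : ℂ =>
      ∑ n ∈ Finset.range (q * M), χ ((n + 1 : ℕ) : ZMod q) * ((n + 1 : ℕ) : ℂ) ^ (-s) +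
        (q : ℂ) ^ (-s) * ∑ r ∈ Finset.range q,
          χ ((r + 1 : ℕ) : ZMod q) * hurwitzTailDiff M s ((r + 1 : ℕ) / q)) {s | 0 < s.re} := by
    refine (DifferentiableOn.fun_sum fun n _ => ?_).add (((hcpow q (NeZero.ne q)).differentiableOn).mul
      (DifferentiableOn.fun_sum fun r hr => ?_))
    · exact ((hcpow (n + 1) n.succ_ne_zero).const_mul _).differentiableOn
    · exact (differentiableOn_hurwitzTailDiff hM (succ_div_mem_Icc hr)).const_mul _
  refine ((DirichletCharacter.differentiable_LFunction hχ).differentiableOn.analyticOnNhd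
    hopen).eqOn_of_preconnected_of_eventuallyEq (hrhs.analyticOnNhd hopen)
    (convex_halfSpace_re_gt 0).isPreconnected (z₀ := 2) (by simp) ?_ hs
  filter_upwards [(isOpen_lt continuous_const continuous_re).mem_nhds
    (show (1 : ℝ) < (2 : ℂ).re by simp)] with z hz
  exact dirichletCharacter_LFunction_eq_of_one_lt_re hχ hM hz

lemma norm_LFunction_sub_sum_le {χ : DirichletCharacter ℂ q} (hχ : χ ≠ 1)
    {M : ℕ} (hM : 1 ≤ M) {s : ℂ} (hs : 0 < s.re) {B : ℝ}
    (hB : ∀ u ∈ Set.Icc (0 : ℝ) 1, ‖hurwitzTail M (s + 1) u‖ ≤ B) :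
    ‖DirichletCharacter.LFunction χ s -
      ∑ n ∈ Finset.range (q * M), χ ((n + 1 : ℕ) : ZMod q) * ((n + 1 : ℕ) : ℂ) ^ (-s)‖ ≤
        q * (‖s‖ * B) := by
  have hq : (1 : ℝ) ≤ q := by exact_mod_cast NeZero.one_le
  have hB0 : 0 ≤ B := (norm_nonneg _).trans (hB 0 (by simp))
  rw [dirichletCharacter_LFunction_eq_sum_add_tail hχ hM hs, add_sub_cancel_left, norm_mul]
  have h1 : ‖(q : ℂ) ^ (-s)‖ ≤ 1 := by
    rw [← ofReal_natCast]
    simpa using norm_ofReal_cpow_neg_le one_pos hq hs.le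
  have h2 : ‖∑ r ∈ Finset.range q, χ ((r + 1 : ℕ) : ZMod q) *
      hurwitzTailDiff M s ((r + 1 : ℕ) / q)‖ ≤ q * (‖s‖ * B) := by
    refine (norm_sum_le_of_le _ (f := fun r => _) (n := fun _ => ‖s‖ * B) fun r hr => ?_).trans
      (by simp)
    rw [norm_mul]
    have := norm_hurwitzTailDiff_sub_le hM hs hB (u := 0) (by simp) (succ_div_mem_Icc hr)
    rw [hurwitzTailDiff_zero, sub_zero] at this
    exact (mul_le_of_le_one_left (norm_nonneg _) (χ.norm_le_one _)).trans this
  calc _ ≤ 1 * (q * (‖s‖ * B)) := by gcongr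
    _ = _ := one_mul _

/-- Approximation of `L(s, χ)` by a Dirichlet polynomial of length `≍ 2 ^ k` on
`2 ^ k ≤ |t| ≤ 2 ^ (k + 1)`. -/
lemma exists_norm_LFunction_sub_sum_le {χ : DirichletCharacter ℂ q} (hχ : χ ≠ 1) :
    ∃ C : ℝ, 0 ≤ C ∧ ∀ (k : ℕ) (s : ℂ), 1 / 2 ≤ s.re → s.re ≤ 2 → 2 ^ k ≤ |s.im| →
      |s.im| ≤ 2 * 2 ^ k → ‖DirichletCharacter.LFunction χ s -
        ∑ n ∈ Finset.range (q * 2 ^ (k + 5)),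
          χ ((n + 1 : ℕ) : ZMod q) * ((n + 1 : ℕ) : ℂ) ^ (-s)‖ ≤ C := by
  set Z := ∑' m : ℕ, (m + 1 / 2 : ℝ) ^ (-(3 / 2) : ℝ)
  have hZ : 0 ≤ Z := tsum_nonneg fun m => by positivity
  refine ⟨q * (64 + Z), by positivity, fun k s h1 h2 h3 h4 => ?_⟩
  have hM : 1 ≤ 2 ^ (k + 5) := Nat.one_le_two_pow
  have hMc : ((2 ^ (k + 5) : ℕ) : ℝ) = 32 * 2 ^ k := by push_cast; ring
  have hk : (k + 1 : ℝ) ≤ 2 ^ k := by exact_mod_cast Nat.lt_two_pow_self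
  have hsn : ‖s‖ ≤ 2 * 2 ^ k + 2 := by
    refine (norm_le_abs_re_add_abs_im s).trans ?_
    rw [abs_of_nonneg (by linarith)]
    linarith
  have hV : (1 : ℝ) ≤ 2 ^ k := one_le_pow₀ (by norm_num)
  have hb := fun (u : ℝ) hu => norm_hurwitzTail_le_iterate hM (2 * (k + 5)) (τ := 2 ^ k)
    (by positivity) h1 h3 (by rw [hMc]; push_cast; linarith) (u := u) hu
  refine (norm_LFunction_sub_sum_le hχ hM (by linarith) hb).trans ?_
  have hM1 : (1 : ℝ) ≤ ((2 ^ (k + 5) : ℕ) : ℝ) := by exact_mod_cast hM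
  have hp : ((2 ^ (k + 5) : ℕ) : ℝ) ^ (-(s.re + 1)) ≤ (32 * 2 ^ k)⁻¹ := by
    rw [← hMc, ← Real.rpow_neg_one]
    exact Real.rpow_le_rpow_of_exponent_le hM1 (by linarith)
  have he : 2 * (((2 ^ (k + 5) : ℕ) : ℝ) / 2 ^ k) +
      ((2 ^ (k + 5) : ℕ) : ℝ) ^ 2 * Z / 2 ^ (2 * (k + 5)) = 64 + Z := by
    push_cast
    rw [← pow_mul, mul_comm 2 (k + 5), pow_add]
    field_simp
    ring
  change _ * (_ * (_ * (2 * (((2 ^ (k + 5) : ℕ) : ℝ) / 2 ^ k) +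
      ((2 ^ (k + 5) : ℕ) : ℝ) ^ 2 * Z / 2 ^ (2 * (k + 5))))) ≤ _
  rw [he]
  gcongr
  have h5 : ‖s‖ * ((2 ^ (k + 5) : ℕ) : ℝ) ^ (-(s.re + 1)) ≤ 1 := by
    calc _ ≤ (32 * 2 ^ k) * (32 * 2 ^ k : ℝ)⁻¹ := by
          gcongr
          linarith
      _ = 1 := by field_simp
  rw [← mul_assoc]
  exact mul_le_of_le_one_left (by positivity) h5

end DirichletCharacter

lemma norm_integral_exp_mul_I_le {θ : ℝ} (hθ : θ ≠ 0) (a b : ℝ) :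
    ‖∫ t in a..b, exp (θ * I * t)‖ ≤ 2 / |θ| := by
  have hc : (θ * I : ℂ) ≠ 0 := mul_ne_zero (ofReal_ne_zero.2 hθ) I_ne_zero
  have hn : ∀ t : ℝ, ‖exp (θ * I * t)‖ = 1 := fun t => by
    rw [mul_right_comm, ← ofReal_mul, norm_exp_ofReal_mul_I]
  rw [integral_exp_mul_complex hc, norm_div, norm_mul, norm_I, mul_one, norm_real,
    Real.norm_eq_abs]
  gcongr
  refine (norm_sub_le _ _).trans ?_
  rw [hn, hn]
  norm_num

/-- Mean square of an exponential sum with distinct frequencies. -/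
lemma integral_norm_sq_sum_exp_le {ι : Type*} [DecidableEq ι] (S : Finset ι) (d : ι → ℂ)
    {l : ι → ℝ} (hl : l.Injective) {a b : ℝ} (hab : a ≤ b) :
    ∫ t in a..b, ‖∑ i ∈ S, d i * exp (l i * I * t)‖ ^ 2 ≤
      ∑ i ∈ S, ∑ j ∈ S, ‖d i‖ * ‖d j‖ * (if i = j then b - a else 2 / |l i - l j|) := by
  have hexp : ∀ t : ℝ, ((‖∑ i ∈ S, d i * exp (l i * I * t)‖ ^ 2 : ℝ) : ℂ) =
      ∑ i ∈ S, ∑ j ∈ S,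
        d i * (starRingEnd ℂ) (d j) * exp (((l i - l j : ℝ) : ℂ) * I * t) := by
    intro t
    rw [ofReal_pow, ← mul_conj', map_sum, Finset.sum_mul_sum]
    refine Finset.sum_congr rfl fun i _ => Finset.sum_congr rfl fun j _ => ?_
    rw [map_mul, ← exp_conj, mul_mul_mul_comm, ← exp_add]
    congr 2
    simp only [map_mul, conj_ofReal, conj_I, ofReal_sub]
    ring
  have hint : ∀ i j, IntervalIntegrable (fun t : ℝ =>
      d i * (starRingEnd ℂ) (d j) * exp (((l i - l j : ℝ) : ℂ) * I * t))
      MeasureTheory.volume a b := fun i j =>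
    Continuous.intervalIntegrable (by fun_prop) _ _
  have h1 : ((∫ t in a..b, ‖∑ i ∈ S, d i * exp (l i * I * t)‖ ^ 2 : ℝ) : ℂ) =
      ∑ i ∈ S, ∑ j ∈ S, d i * (starRingEnd ℂ) (d j) *
        ∫ t in a..b, exp (((l i - l j : ℝ) : ℂ) * I * t) := by
    rw [← intervalIntegral.integral_ofReal]
    simp_rw [hexp]
    rw [intervalIntegral.integral_finsetSum fun i _ =>
      Continuous.intervalIntegrable (by fun_prop) _ _]
    refine Finset.sum_congr rfl fun i _ => ?_
    rw [intervalIntegral.integral_finsetSum fun j _ => hint i j]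
    simp_rw [intervalIntegral.integral_const_mul]
  refine (le_abs_self _).trans ?_
  rw [← Real.norm_eq_abs, ← norm_real, h1]
  refine norm_sum_le_of_le _ fun i _ => norm_sum_le_of_le _ fun j _ => ?_
  rw [norm_mul, norm_mul, RCLike.norm_conj]
  gcongr
  split_ifs with hij
  · subst hij
    simp [-ofReal_sub, abs_of_nonneg (sub_nonneg.2 hab)]
  · exact norm_integral_exp_mul_I_le (sub_ne_zero.2 (hl.ne hij)) a b

lemma rpow_neg_mul_rpow_neg_div_log_le {σ x y : ℝ} (hσ : 1 / 2 ≤ σ) (hx : 1 ≤ x) (hxy : x < y) :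
    x ^ (-σ) * y ^ (-σ) * (2 / (Real.log y - Real.log x)) ≤ 2 * (y - x)⁻¹ + x⁻¹ := by
  have hx0 : 0 < x := by linarith
  have hy0 : 0 < y := by linarith
  have hd : 0 < y - x := by linarith
  set w := √(x * y) with hw
  have hw0 : 0 < w := Real.sqrt_pos.2 (by positivity)
  have hw2 : w ^ 2 = x * y := Real.sq_sqrt (by positivity)
  have h1 : x ^ (-σ) * y ^ (-σ) ≤ w⁻¹ := by
    rw [← Real.mul_rpow hx0.le hy0.le, hw, Real.sqrt_eq_rpow, ← Real.rpow_neg (by positivity)]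
    exact Real.rpow_le_rpow_of_exponent_le (by nlinarith) (by linarith)
  have h2 : (y - x) / y ≤ Real.log y - Real.log x := by
    rw [← Real.log_div hy0.ne' hx0.ne']
    refine le_trans (le_of_eq ?_) (Real.one_sub_inv_le_log_of_pos (by positivity))
    field_simp
  have h3 : 2 / (Real.log y - Real.log x) ≤ 2 / ((y - x) / y) := by gcongr
  have h4 : w⁻¹ ≤ (x + y) / (2 * x * y) := by
    rw [inv_le_comm₀ hw0 (by positivity), inv_div, div_le_iff₀ (by positivity)]
    have h5 : w ≤ (x + y) / 2 :=
      Real.sqrt_le_iff.2 ⟨by positivity, by nlinarith [sq_nonneg (x - y)]⟩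
    nlinarith
  calc _ ≤ (x + y) / (2 * x * y) * (2 / ((y - x) / y)) := by
        have : 0 ≤ 2 / (Real.log y - Real.log x) :=
          div_nonneg (by norm_num) (sub_nonneg.2 (Real.log_le_log hx0 hxy.le))
        exact mul_le_mul (h1.trans h4) h3 this (by positivity)
    _ = _ := by field_simp; ring

lemma sum_range_sub_inv_le {N n : ℕ} (hn : n ∈ Finset.range N) :
    ∑ m ∈ Finset.range N, ((n - m : ℕ) : ℝ)⁻¹ ≤ ∑ j ∈ Finset.range N, ((j : ℝ) + 1)⁻¹ := by
  have hn' : n ≤ N := (Finset.mem_range.1 hn).le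
  calc _ = ∑ m ∈ Finset.range n, ((n - m : ℕ) : ℝ)⁻¹ := by
        refine (Finset.sum_subset (Finset.range_mono hn') fun m _ hm => ?_).symm
        rw [Nat.sub_eq_zero_of_le (by simpa using hm)]
        simp
    _ = ∑ j ∈ Finset.range n, ((j : ℝ) + 1)⁻¹ := by
        rw [← Finset.sum_range_reflect]
        refine Finset.sum_congr rfl fun j hj => ?_
        have hj' := Finset.mem_range.1 hj
        rw [show n - (n - 1 - j) = j + 1 by omega]
        simp
    _ ≤ _ := Finset.sum_le_sum_of_subset_of_nonneg (Finset.range_mono hn') fun _ _ _ => by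
        positivity

/-- Mean square of a Dirichlet polynomial with bounded coefficients to the right of `Re s = 1/2`. -/
lemma integral_norm_sq_dirichlet_polynomial_le {c : ℕ → ℂ} (hc : ∀ n, ‖c n‖ ≤ 1) (N : ℕ)
    {σ a b : ℝ} (hσ : 1 / 2 ≤ σ) (hab : a ≤ b) :
    ∫ t in a..b, ‖∑ n ∈ Finset.range N, c n * ((n + 1 : ℕ) : ℂ) ^ (-((σ : ℂ) + t * I))‖ ^ 2 ≤
      (b - a + 8 * N) * ∑ n ∈ Finset.range N, ((n : ℝ) + 1)⁻¹ := by
  set H := ∑ n ∈ Finset.range N, ((n : ℝ) + 1)⁻¹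
  let l : ℕ → ℝ := fun n => -Real.log (n + 1)
  have hl : l.Injective := fun m n h => by
    have := Real.log_injOn_pos (Set.mem_Ioi.2 (by positivity : (0 : ℝ) < m + 1))
      (Set.mem_Ioi.2 (by positivity : (0 : ℝ) < n + 1)) (neg_injective h)
    exact_mod_cast add_right_cancel this
  let d : ℕ → ℂ := fun n => c n * ((n + 1 : ℕ) : ℂ) ^ (-(σ : ℂ))
  have hterm : ∀ (n : ℕ) (t : ℝ), c n * ((n + 1 : ℕ) : ℂ) ^ (-((σ : ℂ) + t * I)) =
      d n * exp (l n * I * t) := by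
    intro n t
    have h0 : ((n + 1 : ℕ) : ℂ) ≠ 0 := by exact_mod_cast n.succ_ne_zero
    simp only [d, l]
    rw [neg_add, cpow_add _ _ h0, mul_assoc, cpow_def_of_ne_zero h0 (-(t * I)), natCast_log.symm]
    congr 3
    push_cast
    ring
  have hd : ∀ n, ‖d n‖ ≤ ((n : ℝ) + 1) ^ (-σ) := by
    intro n
    rw [norm_mul, ← ofReal_natCast, norm_cpow_eq_rpow_re_of_pos (by positivity), neg_re, ofReal_re,
      Nat.cast_succ]
    exact mul_le_of_le_one_left (by positivity) (hc n)
  simp_rw [hterm]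
  refine (integral_norm_sq_sum_exp_le _ d hl hab).trans ?_
  have hpair : ∀ m n : ℕ, m < n → ‖d m‖ * ‖d n‖ * (2 / |l m - l n|) ≤
      2 * ((n - m : ℕ) : ℝ)⁻¹ + ((m : ℝ) + 1)⁻¹ := by
    intro m n hmn
    have hmn' : (m : ℝ) + 1 < n + 1 := by exact_mod_cast Nat.succ_lt_succ hmn
    have hlog : |l m - l n| = Real.log (n + 1) - Real.log (m + 1) := by
      simp only [l]
      rw [neg_sub_neg, abs_of_nonneg (sub_nonneg.2 (Real.log_le_log (by positivity) hmn'.le))]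
    have := rpow_neg_mul_rpow_neg_div_log_le hσ (x := m + 1) (y := n + 1)
      (by linarith [m.cast_nonneg (α := ℝ)]) hmn'
    rw [add_sub_add_right_eq_sub, ← Nat.cast_sub hmn.le] at this
    rw [hlog]
    refine le_trans ?_ this
    have : 0 ≤ 2 / (Real.log (n + 1) - Real.log (m + 1)) := by
      rw [← hlog]; positivity
    gcongr
    exacts [hd m, hd n]
  have hall : ∀ m n : ℕ, ‖d m‖ * ‖d n‖ * (if m = n then b - a else 2 / |l m - l n|) ≤
      (if m = n then (b - a) * ((n : ℝ) + 1)⁻¹ else 0) + 2 * ((n - m : ℕ) : ℝ)⁻¹ +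
        2 * ((m - n : ℕ) : ℝ)⁻¹ + 2 * ((m : ℝ) + 1)⁻¹ + 2 * ((n : ℝ) + 1)⁻¹ := by
    intro m n
    have hm : 0 ≤ ((m : ℝ) + 1)⁻¹ := by positivity
    have hn : 0 ≤ ((n : ℝ) + 1)⁻¹ := by positivity
    rcases lt_trichotomy m n with h | h | h
    · rw [if_neg h.ne, if_neg h.ne, Nat.sub_eq_zero_of_le h.le, Nat.cast_zero, inv_zero]
      linarith [hpair m n h]
    · subst h
      have h1 : ‖d m‖ * ‖d m‖ ≤ ((m : ℝ) + 1)⁻¹ := by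
        have h2 : ‖d m‖ * ‖d m‖ ≤ ((m : ℝ) + 1) ^ (-σ) * ((m : ℝ) + 1) ^ (-σ) := by
          gcongr <;> exact hd m
        refine h2.trans ?_
        rw [← Real.rpow_add (by positivity), ← Real.rpow_neg_one]
        exact Real.rpow_le_rpow_of_exponent_le (by linarith [m.cast_nonneg (α := ℝ)])
          (by linarith)
      have h2 := mul_le_mul_of_nonneg_right h1 (sub_nonneg.2 hab)
      simp only [if_true, Nat.sub_self, Nat.cast_zero, inv_zero]
      linarith
    · rw [if_neg h.ne', if_neg h.ne', Nat.sub_eq_zero_of_le h.le, Nat.cast_zero, inv_zero,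
        mul_comm ‖d m‖, abs_sub_comm]
      linarith [hpair n m h]
  refine (Finset.sum_le_sum fun m _ => Finset.sum_le_sum fun n _ => hall m n).trans ?_
  simp_rw [Finset.sum_add_distrib, ← Finset.mul_sum]
  have e1 : ∑ m ∈ Finset.range N, ∑ n ∈ Finset.range N,
      (if m = n then (b - a) * ((n : ℝ) + 1)⁻¹ else 0) = (b - a) * H := by
    rw [Finset.mul_sum]
    refine Finset.sum_congr rfl fun m hm => ?_
    rw [Finset.sum_ite_eq, if_pos hm]
  have e2 : ∑ m ∈ Finset.range N, ∑ n ∈ Finset.range N, ((m - n : ℕ) : ℝ)⁻¹ ≤ N * H := by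
    refine (Finset.sum_le_sum fun m hm => sum_range_sub_inv_le hm).trans ?_
    simp [H]
  have e3 : ∑ m ∈ Finset.range N, ∑ n ∈ Finset.range N, ((n - m : ℕ) : ℝ)⁻¹ ≤ N * H := by
    rw [Finset.sum_comm]
    exact e2
  have e4 : ∑ _m ∈ Finset.range N, H = N * H := by simp
  have e5 : ∑ m ∈ Finset.range N, ∑ _n ∈ Finset.range N, ((m : ℝ) + 1)⁻¹ = N * H := by
    rw [Finset.sum_comm, e4]
  rw [e1, e4, e5]
  linarith

section DirichletCharacter

variable {q : ℕ} [NeZero q]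

lemma continuous_norm_LFunction_div {χ : DirichletCharacter ℂ q} (hχ : χ ≠ 1) {σ : ℝ}
    (hσ : 1 / 2 ≤ σ) :
    Continuous fun t : ℝ => ‖DirichletCharacter.LFunction χ ((σ : ℂ) + (t : ℂ) * I)‖ /
      ‖(σ : ℂ) + (t : ℂ) * I‖ := by
  have hs : Continuous fun t : ℝ => (σ : ℂ) + (t : ℂ) * I := by fun_prop
  refine (((DirichletCharacter.differentiable_LFunction hχ).continuous.comp hs).norm).div hs.norm
    fun t h => ?_
  have := congrArg re (norm_eq_zero.1 h)
  simp at this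
  linarith

lemma sum_range_inv_le_one_add_log (N : ℕ) :
    ∑ n ∈ Finset.range N, ((n : ℝ) + 1)⁻¹ ≤ 1 + Real.log N := by
  have := harmonic_le_one_add_log N
  simpa [harmonic] using this

lemma exists_integral_norm_LFunction_div_dyadic_le {χ : DirichletCharacter ℂ q} (hχ : χ ≠ 1) :
    ∃ C : ℝ, 0 ≤ C ∧ ∀ (k : ℕ) (σ a b : ℝ), 1 / 2 ≤ σ → σ ≤ 2 → b - a = 2 ^ k →
      (∀ t ∈ Set.Icc a b, 2 ^ k ≤ |t| ∧ |t| ≤ 2 * 2 ^ k) →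
      ∫ t in a..b, ‖DirichletCharacter.LFunction χ ((σ : ℂ) + (t : ℂ) * I)‖ /
        ‖(σ : ℂ) + (t : ℂ) * I‖ ≤ C * (k + 1) := by
  obtain ⟨C₀, hC₀, hC⟩ := exists_norm_LFunction_sub_sum_le hχ
  have hq : (1 : ℝ) ≤ q := by exact_mod_cast NeZero.one_le
  have hlog : 0 ≤ Real.log (32 * q) := Real.log_nonneg (by linarith)
  refine ⟨(1 + 256 * q) * (1 + Real.log (32 * q)) + (1 + C₀), by positivity,
    fun k σ a b h1 h2 hab ht => ?_⟩
  have hV : (0 : ℝ) < 2 ^ k := by positivity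
  have hab' : a ≤ b := by linarith
  set N := q * 2 ^ (k + 5) with hN
  have hNc : (N : ℝ) = 32 * q * 2 ^ k := by rw [hN]; push_cast; ring
  let P : ℝ → ℂ := fun t => ∑ n ∈ Finset.range N,
    χ ((n + 1 : ℕ) : ZMod q) * ((n + 1 : ℕ) : ℂ) ^ (-((σ : ℂ) + t * I))
  have hP : Continuous P := by
    refine continuous_finsetSum _ fun n _ => continuous_const.mul ?_
    exact Continuous.const_cpow (by fun_prop) (Or.inl (by exact_mod_cast n.succ_ne_zero))
  have hpt : ∀ t ∈ Set.Icc a b, ‖DirichletCharacter.LFunction χ ((σ : ℂ) + (t : ℂ) * I)‖ /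
      ‖(σ : ℂ) + (t : ℂ) * I‖ ≤ (‖P t‖ ^ 2 + (1 + C₀)) / 2 ^ k := by
    intro t hmem
    obtain ⟨h3, h4⟩ := ht t hmem
    have hn : 2 ^ k ≤ ‖(σ : ℂ) + (t : ℂ) * I‖ := by
      refine h3.trans ?_
      simpa using abs_im_le_norm ((σ : ℂ) + (t : ℂ) * I)
    have h5 := hC k ((σ : ℂ) + (t : ℂ) * I) (by simpa using h1) (by simpa using h2)
      (by simpa using h3) (by simpa using h4)
    have h6 := norm_le_norm_add_norm_sub' (DirichletCharacter.LFunction χ ((σ : ℂ) + (t : ℂ) * I))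
      (P t)
    gcongr
    have h7 : ‖DirichletCharacter.LFunction χ ((σ : ℂ) + (t : ℂ) * I)‖ ≤ ‖P t‖ + C₀ :=
      h6.trans (add_le_add_right h5 _)
    nlinarith [sq_nonneg (‖P t‖ - 1)]
  have hmono := intervalIntegral.integral_mono_on (μ := MeasureTheory.volume) hab'
    ((continuous_norm_LFunction_div hχ h1).intervalIntegrable _ _)
    (Continuous.intervalIntegrable (by fun_prop) _ _) hpt
  refine hmono.trans ?_
  rw [intervalIntegral.integral_div, intervalIntegral.integral_add
    (Continuous.intervalIntegrable (by fun_prop) _ _)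
    (Continuous.intervalIntegrable (by fun_prop) _ _), intervalIntegral.integral_const, hab,
    smul_eq_mul, div_le_iff₀ hV]
  have hms := integral_norm_sq_dirichlet_polynomial_le
    (c := fun n => χ ((n + 1 : ℕ) : ZMod q)) (fun n => χ.norm_le_one _) N h1 hab'
  rw [hab, hNc] at hms
  have hH := sum_range_inv_le_one_add_log N
  have hlogN : Real.log N ≤ Real.log (32 * q) + k := by
    rw [hNc, Real.log_mul (by positivity) hV.ne', Real.log_pow]
    have : Real.log 2 ≤ 1 := by linarith [Real.log_two_lt_d9]
    have : (k : ℝ) * Real.log 2 ≤ k := mul_le_of_le_one_right k.cast_nonneg this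
    linarith
  have hk : (0 : ℝ) ≤ k := k.cast_nonneg
  have hH' : ∑ n ∈ Finset.range N, ((n : ℝ) + 1)⁻¹ ≤ (1 + Real.log (32 * q)) * (k + 1) := by
    nlinarith [mul_nonneg hlog hk]
  have hms' : ∫ t in a..b, ‖P t‖ ^ 2 ≤
      (2 ^ k + 8 * (32 * q * 2 ^ k)) * ((1 + Real.log (32 * q)) * (k + 1)) :=
    hms.trans (by gcongr)
  have : (2 : ℝ) ^ k * (1 + C₀) ≤ 2 ^ k * (1 + C₀) * (k + 1) :=
    le_mul_of_one_le_right (by positivity) (by linarith)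
  nlinarith

lemma exists_norm_LFunction_div_le_of_abs_le_one {χ : DirichletCharacter ℂ q} (hχ : χ ≠ 1) :
    ∃ B : ℝ, 0 ≤ B ∧ ∀ σ t : ℝ, 1 / 2 ≤ σ → σ ≤ 2 → |t| ≤ 1 →
      ‖DirichletCharacter.LFunction χ ((σ : ℂ) + (t : ℂ) * I)‖ /
        ‖(σ : ℂ) + (t : ℂ) * I‖ ≤ B := by
  obtain ⟨B, hB⟩ := (isCompact_closedBall (0 : ℂ) 3).exists_bound_of_continuousOn
    (DirichletCharacter.differentiable_LFunction hχ).continuous.continuousOn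
  have hB0 : 0 ≤ B := (norm_nonneg _).trans (hB 0 (by simp))
  refine ⟨B / (1 / 2), by positivity, fun σ t h1 h2 ht => ?_⟩
  have hn : 1 / 2 ≤ ‖(σ : ℂ) + (t : ℂ) * I‖ := by
    refine h1.trans ((le_abs_self _).trans ?_)
    simpa using abs_re_le_norm ((σ : ℂ) + (t : ℂ) * I)
  have hmem : (σ : ℂ) + (t : ℂ) * I ∈ Metric.closedBall (0 : ℂ) 3 := by
    rw [mem_closedBall_zero_iff]
    refine (norm_le_abs_re_add_abs_im _).trans ?_
    simp only [add_re, ofReal_re, mul_re, I_re, mul_zero, ofReal_im, I_im, mul_one, sub_self,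
      add_zero, add_im, mul_im, zero_add]
    rw [abs_of_nonneg (by linarith)]
    linarith
  gcongr
  exact hB _ hmem

lemma exists_integral_norm_LFunction_div_two_pow_le {χ : DirichletCharacter ℂ q} (hχ : χ ≠ 1) :
    ∃ C : ℝ, 0 ≤ C ∧ ∀ (k : ℕ) (σ : ℝ), 1 / 2 ≤ σ → σ ≤ 2 →
      ∫ t in (-(2 : ℝ) ^ k)..2 ^ k, ‖DirichletCharacter.LFunction χ ((σ : ℂ) + (t : ℂ) * I)‖ /
        ‖(σ : ℂ) + (t : ℂ) * I‖ ≤ C * (k + 1) ^ 2 := by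
  obtain ⟨C, hC0, hC⟩ := exists_integral_norm_LFunction_div_dyadic_le hχ
  obtain ⟨B, hB0, hB⟩ := exists_norm_LFunction_div_le_of_abs_le_one hχ
  refine ⟨2 * B + 2 * C, by positivity, fun k σ h1 h2 => ?_⟩
  have hint := fun a b => (continuous_norm_LFunction_div hχ h1).intervalIntegrable
    (μ := MeasureTheory.volume) a b
  induction k with
  | zero =>
    have := intervalIntegral.integral_mono_on (μ := MeasureTheory.volume) (a := -1) (b := 1)
      (by norm_num) (hint _ _) (intervalIntegrable_const (c := B))
      fun t ht => hB σ t h1 h2 (abs_le.2 ht)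
    rw [intervalIntegral.integral_const, smul_eq_mul] at this
    simp only [pow_zero, Nat.cast_zero, zero_add, one_pow, mul_one]
    linarith
  | succ k ih =>
    have hV : (0 : ℝ) < 2 ^ k := by positivity
    have hr := hC k σ (2 ^ k) (2 ^ (k + 1)) h1 h2 (by ring) fun t ht => by
      rw [pow_succ'] at ht
      rw [abs_of_nonneg (hV.le.trans ht.1)]
      exact ht
    have hl := hC k σ (-2 ^ (k + 1)) (-2 ^ k) h1 h2 (by ring) fun t ht => by
      rw [pow_succ'] at ht
      rw [abs_of_nonpos (by linarith [ht.2])]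
      constructor <;> linarith [ht.1, ht.2]
    rw [← intervalIntegral.integral_add_adjacent_intervals (hint _ (2 ^ k)) (hint _ _),
      ← intervalIntegral.integral_add_adjacent_intervals (hint _ (-2 ^ k)) (hint _ _)]
    push_cast
    have hk : (0 : ℝ) ≤ k := k.cast_nonneg
    nlinarith [mul_nonneg hB0 hk, mul_nonneg hC0 hk]

end DirichletCharacter

/-- Unconditionally, uniformly for `1/2 ≤ σ ≤ 2` and `T ≥ 2`,
`∫_{-T}^{T} |L(σ+it,χ)| / |σ+it| dt ≪_q (log T)²`. -/
theorem stmt9 (q : ℕ) [NeZero q] (hq : 3 ≤ q) (χ : DirichletCharacter ℂ q)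
    (hχ : χ ≠ 1) (hχreal : ∀ n : ZMod q, (χ n).im = 0) :
    ∃ C > 0, ∀ σ T : ℝ, 1/2 ≤ σ → σ ≤ 2 → 2 ≤ T →
      (∫ t in (-T)..T,
          ‖DirichletCharacter.LFunction χ ((σ : ℂ) + (t : ℂ) * I)‖ /
            ‖(σ : ℂ) + (t : ℂ) * I‖) ≤ C * Real.log T ^ 2 := by
  obtain ⟨C, hC0, hC⟩ := exists_integral_norm_LFunction_div_two_pow_le hχ
  have hl2 : 0 < Real.log 2 := Real.log_pos (by norm_num)
  refine ⟨(C + 1) * (3 / Real.log 2) ^ 2, by positivity, fun σ T h1 h2 hT => ?_⟩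
  have hlT : Real.log 2 ≤ Real.log T := Real.log_le_log (by norm_num) hT
  set K := ⌈Real.log T / Real.log 2⌉₊
  have hK1 : Real.log T / Real.log 2 ≤ K := Nat.le_ceil _
  have hK2 : (K : ℝ) + 1 ≤ 3 / Real.log 2 * Real.log T := by
    have h3 : (K : ℝ) < Real.log T / Real.log 2 + 1 := Nat.ceil_lt_add_one (div_nonneg (hl2.le.trans hlT) hl2.le)
    have h4 : 1 ≤ Real.log T / Real.log 2 := (one_le_div hl2).2 hlT
    rw [div_mul_eq_mul_div, mul_div_assoc]
    linarith
  have hTK : T ≤ 2 ^ K := by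
    rw [← Real.log_le_log_iff (by linarith) (by positivity), Real.log_pow]
    exact (div_le_iff₀ hl2).1 hK1
  calc _ ≤ ∫ t in (-(2 : ℝ) ^ K)..2 ^ K,
        ‖DirichletCharacter.LFunction χ ((σ : ℂ) + (t : ℂ) * I)‖ / ‖(σ : ℂ) + (t : ℂ) * I‖ :=
        intervalIntegral.integral_mono_interval (by linarith) (by linarith) hTK
          (Filter.Eventually.of_forall fun t => by positivity)
          ((continuous_norm_LFunction_div hχ h1).intervalIntegrable _ _)
    _ ≤ C * (K + 1) ^ 2 := hC K σ h1 h2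
    _ ≤ (C + 1) * (3 / Real.log 2 * Real.log T) ^ 2 := by gcongr; linarith
    _ = _ := by ring
end

section
/- Unconditionally, uniformly for 1/2 ≤ σ ≤ 2 and T ≥ 2, one has ∫_{−T}^{T} |L(σ+it, χ)|² / |σ+it| dt ≪ (log T)², with implied constant depending only on q. -/
open Complex

section Plancherel

open MeasureTheory FourierTransform SchwartzMap
open scoped ContDiff

/-- The `L²` Fourier transform of an integrable function is given by the Fourier integral. -/
theorem coeFn_fourier_toLp_ae_eq {f : ℝ → ℂ} (hf : Integrable f) (hf2 : MemLp f 2) :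
    (𝓕 hf2.toLp : Lp ℂ 2 (volume : Measure ℝ)) =ᵐ[volume] 𝓕 f := by
  refine ae_eq_of_integral_contDiff_smul_eq
    ((Lp.memLp _).locallyIntegrable (by norm_num)) ?_ ?_
  · exact (VectorFourier.fourierIntegral_continuous Real.continuous_fourierChar
      (innerSL ℝ).continuous₂ hf).locallyIntegrable
  · intro g hg hgc
    have hgc' : HasCompactSupport (Complex.ofRealCLM ∘ g) := hgc.comp_left rfl
    have hg' : ContDiff ℝ ∞ (Complex.ofRealCLM ∘ g) := by fun_prop
    let G : 𝓢(ℝ, ℂ) := hgc'.toSchwartzMap hg'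
    have hG : ∀ x, G x = (g x : ℂ) := fun x ↦ rfl
    have key := congrArg (fun D : 𝓢'(ℝ, ℂ) ↦ D G)
      (Lp.fourier_toTemperedDistribution_eq hf2.toLp)
    simp only [TemperedDistribution.fourier_apply, Lp.toTemperedDistribution_apply] at key
    have flip : ∫ x, (𝓕 G) x • f x = ∫ x, G x • 𝓕 f x := by
      have := VectorFourier.integral_fourierIntegral_smul_eq_flip (L := innerₗ ℝ)
        Real.continuous_fourierChar continuous_inner (G.integrable (μ := volume)) hf
      rw [SchwartzMap.fourier_coe]
      simpa using! this
    have hcongr : ∫ x, (𝓕 G) x • (hf2.toLp : Lp ℂ 2 (volume : Measure ℝ)) x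
        = ∫ x, (𝓕 G) x • f x := by
      refine integral_congr_ae ?_
      filter_upwards [hf2.coeFn_toLp] with x hx
      rw [hx]
    rw [hcongr, flip] at key
    simpa [hG] using key.symm

theorem memLp_fourier {f : ℝ → ℂ} (hf : Integrable f) (hf2 : MemLp f 2) : MemLp (𝓕 f) 2 :=
  (memLp_congr_ae (coeFn_fourier_toLp_ae_eq hf hf2)).mp (Lp.memLp _)

theorem integral_norm_sq_fourier {f : ℝ → ℂ} (hf : Integrable f) (hf2 : MemLp f 2) :
    ∫ x, ‖𝓕 f x‖ ^ 2 = ∫ x, ‖f x‖ ^ 2 := by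
  have h (g : Lp ℂ 2 (volume : Measure ℝ)) : ‖g‖ ^ 2 = ∫ x, ‖g x‖ ^ 2 := by
    have := congrArg RCLike.re (L2.inner_def (𝕜 := ℂ) g g)
    rw [inner_self_eq_norm_sq] at this
    rw [this, ← integral_re (L2.integrable_inner g g)]
    simp only [inner_self_eq_norm_sq]
  have h1 := h (𝓕 hf2.toLp)
  rw [Lp.norm_fourier_eq, h] at h1
  rw [← integral_congr_ae ((coeFn_fourier_toLp_ae_eq hf hf2).mono fun x hx ↦ by
      simp only [hx] : (fun x ↦ ‖(𝓕 hf2.toLp : Lp ℂ 2 (volume : Measure ℝ)) x‖ ^ 2)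
        =ᵐ[volume] fun x ↦ ‖𝓕 f x‖ ^ 2), ← h1]
  exact integral_congr_ae (hf2.coeFn_toLp.mono fun x hx ↦ by simp only [hx])

end Plancherel

theorem DirichletCharacter.norm_sum_range_le {q : ℕ} [NeZero q] {χ : DirichletCharacter ℂ q}
    (hχ : χ ≠ 1) (n : ℕ) : ‖∑ k ∈ Finset.range n, χ k‖ ≤ q := by
  have hperiod : ∑ k ∈ Finset.range q, χ k = 0 := by
    rw [← MulChar.sum_eq_zero_of_ne_one hχ]
    exact Finset.sum_nbij' (fun i : ℕ ↦ (i : ZMod q)) ZMod.val (by simp)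
      (by simp [ZMod.val_lt]) (fun i hi ↦ ZMod.val_cast_of_lt (by simpa using hi)) (by simp)
      (by simp)
  have hmul (m : ℕ) : ∑ k ∈ Finset.range (q * m), χ k = 0 := by
    induction m with
    | zero => simp
    | succ m ih => rw [mul_add_one, Finset.sum_range_add, ih]; simpa using hperiod
  have hmod : ∑ k ∈ Finset.range n, χ k = ∑ k ∈ Finset.range (n % q), χ k := by
    conv_lhs => rw [← Nat.div_add_mod n q, Finset.sum_range_add, hmul]
    simp
  rw [hmod]
  calc ‖∑ k ∈ Finset.range (n % q), χ k‖ ≤ ∑ k ∈ Finset.range (n % q), (1 : ℝ) :=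
        norm_sum_le_of_le _ fun k _ ↦ DirichletCharacter.norm_le_one χ _
    _ ≤ q := by simpa using (Nat.mod_lt n (NeZero.pos q)).le

theorem DirichletCharacter.norm_sum_Icc_le {q : ℕ} [NeZero q] {χ : DirichletCharacter ℂ q}
    (hχ : χ ≠ 1) (n : ℕ) : ‖∑ k ∈ Finset.Icc 1 n, χ k‖ ≤ q + 1 := by
  have h : ∑ k ∈ Finset.Icc 1 n, χ k = ∑ k ∈ Finset.range (n + 1), χ k - χ 0 := by
    rw [Finset.range_eq_Ico, Finset.sum_eq_sum_Ico_succ_bot (by lia)]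
    simp [Finset.Ico_add_one_right_eq_Icc]
  rw [h]
  exact (norm_sub_le _ _).trans
    (add_le_add (norm_sum_range_le hχ _) (DirichletCharacter.norm_le_one χ _))

section MellinTransform

open MeasureTheory Set Filter Asymptotics Topology

theorem measurable_sum_Icc_floor (a : ℕ → ℂ) :
    Measurable fun x : ℝ ↦ ∑ k ∈ Finset.Icc 1 ⌊x⌋₊, a k :=
  (measurable_from_top (f := fun n : ℕ ↦ ∑ k ∈ Finset.Icc 1 n, a k)).comp Nat.measurable_floor

variable {a : ℕ → ℂ} {B : ℝ}

theorem locallyIntegrableOn_sum_Icc_floor_inv (hB : ∀ n, ‖∑ k ∈ Finset.Icc 1 n, a k‖ ≤ B) :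
    LocallyIntegrableOn (fun x : ℝ ↦ ∑ k ∈ Finset.Icc 1 ⌊x⁻¹⌋₊, a k) (Ioi 0) :=
  ((memLp_top_of_bound ((measurable_sum_Icc_floor a).comp measurable_inv).aestronglyMeasurable B
    (ae_of_all _ fun _ ↦ hB _)).locallyIntegrable le_top).locallyIntegrableOn _

theorem sum_Icc_floor_inv_isBigO_atTop (r : ℝ) :
    (fun x : ℝ ↦ ∑ k ∈ Finset.Icc 1 ⌊x⁻¹⌋₊, a k) =O[atTop] (· ^ r) := by
  refine EventuallyEq.trans_isBigO (f₂ := fun _ ↦ (0 : ℂ)) ?_ (isBigO_zero _ _)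
  filter_upwards [eventually_gt_atTop 1] with x hx
  rw [Nat.floor_eq_zero.mpr (inv_lt_one_of_one_lt₀ hx)]
  simp

theorem sum_Icc_floor_inv_isBigO_zero (hB : ∀ n, ‖∑ k ∈ Finset.Icc 1 n, a k‖ ≤ B) :
    (fun x : ℝ ↦ ∑ k ∈ Finset.Icc 1 ⌊x⁻¹⌋₊, a k) =O[𝓝[>] 0] (· ^ (-0 : ℝ)) := by
  simp only [neg_zero, Real.rpow_zero]
  exact isBigO_of_le' (c := B) _ fun x ↦ by simpa using hB _

theorem mellinConvergent_sum_Icc_floor_inv (hB : ∀ n, ‖∑ k ∈ Finset.Icc 1 n, a k‖ ≤ B)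
    {s : ℂ} (hs : 0 < s.re) :
    MellinConvergent (fun x : ℝ ↦ ∑ k ∈ Finset.Icc 1 ⌊x⁻¹⌋₊, a k) s :=
  mellinConvergent_of_isBigO_rpow (locallyIntegrableOn_sum_Icc_floor_inv hB)
    (sum_Icc_floor_inv_isBigO_atTop (-(s.re + 1))) (by linarith)
    (sum_Icc_floor_inv_isBigO_zero hB) hs

theorem LSeries_eq_mul_mellin (hB : ∀ n, ‖∑ k ∈ Finset.Icc 1 n, a k‖ ≤ B)
    {s : ℂ} (hs : 0 < s.re) (hS : LSeriesSummable a s) :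
    LSeries a s = s * mellin (fun x : ℝ ↦ ∑ k ∈ Finset.Icc 1 ⌊x⁻¹⌋₊, a k) s := by
  rw [LSeries_eq_mul_integral a le_rfl hs hS
    (isBigO_of_le' (c := B) _ fun n ↦ by simpa using hB n),
    mellin_comp_inv (fun x : ℝ ↦ ∑ k ∈ Finset.Icc 1 ⌊x⌋₊, a k), mellin]
  congr 1
  rw [← integral_Ici_eq_integral_Ioi]
  rw [setIntegral_eq_of_subset_of_forall_sdiff_eq_zero (s := Ici 1) measurableSet_Ioi
    (Ici_subset_Ioi.mpr one_pos)]
  · refine integral_congr_ae (ae_of_all _ fun x ↦ ?_)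
    simp only [smul_eq_mul, neg_add']
    ring
  · rintro x ⟨-, hx⟩
    rw [Nat.floor_eq_zero.mpr (by simpa using hx)]
    simp

theorem DirichletCharacter.LFunction_eq_mul_mellin {q : ℕ} [NeZero q]
    {χ : DirichletCharacter ℂ q} (hχ : χ ≠ 1) {s : ℂ} (hs : 0 < s.re) :
    LFunction χ s = s * mellin (fun x : ℝ ↦ ∑ k ∈ Finset.Icc 1 ⌊x⁻¹⌋₊, χ k) s := by
  have hB := norm_sum_Icc_le hχ
  have hopen : IsOpen {s : ℂ | 0 < s.re} := isOpen_lt continuous_const continuous_re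
  have hconv : IsPreconnected {s : ℂ | 0 < s.re} := (convex_halfSpace_re_gt 0).isPreconnected
  refine AnalyticOnNhd.eqOn_of_preconnected_of_eventuallyEq
    (g := fun s ↦ s * mellin (fun x : ℝ ↦ ∑ k ∈ Finset.Icc 1 ⌊x⁻¹⌋₊, χ k) s)
    ((differentiable_LFunction hχ).differentiableOn.analyticOnNhd hopen)
    (DifferentiableOn.analyticOnNhd (fun s hs ↦ ?_) hopen) hconv (z₀ := 2) (by simp) ?_ hs
  · exact (differentiableAt_id.mul (mellin_differentiableAt_of_isBigO_rpow
      (locallyIntegrableOn_sum_Icc_floor_inv hB)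
      (sum_Icc_floor_inv_isBigO_atTop (-(s.re + 1))) (by linarith)
      (sum_Icc_floor_inv_isBigO_zero hB) hs)).differentiableWithinAt
  · filter_upwards [(isOpen_lt continuous_const continuous_re).mem_nhds
      (show (1 : ℝ) < (2 : ℂ).re by simp)] with s hs
    rw [LFunction_eq_LSeries χ hs]
    exact LSeries_eq_mul_mellin hB (one_pos.trans hs) (ZMod.LSeriesSummable_of_one_lt_re χ hs)

end MellinTransform

section ShortSums

open MeasureTheory Set FourierTransform

/-- The sum of `a k` over `exp u < k ≤ exp (u + δ)` (for `δ ≥ 0`). -/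
noncomputable def shortSum (a : ℕ → ℂ) (δ u : ℝ) : ℂ :=
  ∑ k ∈ Finset.Icc 1 ⌊Real.exp (u + δ)⌋₊, a k - ∑ k ∈ Finset.Icc 1 ⌊Real.exp u⌋₊, a k

variable {a : ℕ → ℂ} {B : ℝ}

theorem measurable_shortSum (a : ℕ → ℂ) (δ : ℝ) : Measurable (shortSum a δ) :=
  ((measurable_sum_Icc_floor a).comp (by fun_prop)).sub
    ((measurable_sum_Icc_floor a).comp (by fun_prop))

theorem norm_shortSum_le (hB : ∀ n, ‖∑ k ∈ Finset.Icc 1 n, a k‖ ≤ B) (δ u : ℝ) :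
    ‖shortSum a δ u‖ ≤ 2 * B :=
  (norm_sub_le _ _).trans (by linarith [hB ⌊Real.exp (u + δ)⌋₊, hB ⌊Real.exp u⌋₊])

theorem shortSum_eq_zero {δ u : ℝ} (hδ : 0 ≤ δ) (hu : u < -δ) : shortSum a δ u = 0 := by
  have h1 : ⌊Real.exp (u + δ)⌋₊ = 0 := Nat.floor_eq_zero.mpr (Real.exp_lt_one_iff.mpr (by linarith))
  have h2 : ⌊Real.exp u⌋₊ = 0 := Nat.floor_eq_zero.mpr (Real.exp_lt_one_iff.mpr (by linarith))
  simp [shortSum, h1, h2]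

theorem sum_Icc_floor_eq_sum_ite (a : ℕ → ℂ) {x : ℝ} (hx : 0 ≤ x) {M : ℕ} (hM : ⌊x⌋₊ ≤ M) :
    ∑ k ∈ Finset.Icc 1 ⌊x⌋₊, a k = ∑ k ∈ Finset.Icc 1 M, if (k : ℝ) ≤ x then a k else 0 := by
  rw [← Finset.sum_filter]
  congr 1
  ext k
  simp only [Finset.mem_Icc, Finset.mem_filter, ← Nat.le_floor_iff hx]
  lia

theorem norm_shortSum_le_sum (ha : ∀ n, ‖a n‖ ≤ 1) {δ u : ℝ} (hδ : 0 ≤ δ) {M : ℕ}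
    (hM : u + δ < Real.log (M + 1)) :
    ‖shortSum a δ u‖ ≤ ∑ n ∈ Finset.Icc 1 M,
      (Ico (Real.log n - δ) (Real.log n)).indicator (fun _ ↦ (1 : ℝ)) u := by
  have hfloor : ⌊Real.exp (u + δ)⌋₊ ≤ M := by
    rw [← Nat.lt_add_one_iff, Nat.floor_lt (Real.exp_pos _).le, ← Real.lt_log_iff_exp_lt]
    · exact_mod_cast hM
    · positivity
  have hfloor' : ⌊Real.exp u⌋₊ ≤ M :=
    (Nat.floor_mono (Real.exp_le_exp.mpr (by linarith))).trans hfloor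
  rw [shortSum, sum_Icc_floor_eq_sum_ite a (Real.exp_pos _).le hfloor,
    sum_Icc_floor_eq_sum_ite a (Real.exp_pos _).le hfloor', ← Finset.sum_sub_distrib]
  refine norm_sum_le_of_le _ fun n hn ↦ ?_
  have hn0 : (0 : ℝ) < n := by exact_mod_cast (Finset.mem_Icc.mp hn).1
  simp only [indicator_apply, ← Real.log_le_iff_le_exp hn0]
  by_cases h1 : Real.log n ≤ u
  · rw [if_pos (by linarith), if_pos h1, if_neg (by simp [h1])]
    simp
  · by_cases h2 : Real.log n ≤ u + δ
    · rw [if_pos h2, if_neg h1, if_pos ⟨by linarith, by linarith⟩]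
      simpa using ha n
    · rw [if_neg h2, if_neg h1, if_neg (by simp [h2])]
      simp

theorem norm_exp_smul_shortSum_sq (σ δ u : ℝ) :
    ‖Real.exp (-σ * u) • shortSum a δ u‖ ^ 2 =
      Real.exp (-(2 * σ) * u) * ‖shortSum a δ u‖ ^ 2 := by
  rw [norm_smul, mul_pow, Real.norm_of_nonneg (Real.exp_pos _).le, ← Real.exp_nat_mul]
  congr 2
  push_cast
  ring

theorem integrable_exp_smul_shortSum (hB : ∀ n, ‖∑ k ∈ Finset.Icc 1 n, a k‖ ≤ B)
    {σ δ : ℝ} (hσ : 0 < σ) (hδ : 0 ≤ δ) :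
    Integrable fun u ↦ Real.exp (-σ * u) • shortSum a δ u := by
  have hint : Integrable ((Ici (-δ)).indicator fun u ↦ 2 * B * Real.exp (-σ * u)) :=
    IntegrableOn.integrable_indicator (Integrable.const_mul
      (((integrableOn_Ici_iff_integrableOn_Ioi enorm_ne_top).mpr
        (integrableOn_exp_mul_Ioi (neg_lt_zero.mpr hσ) _))) _) measurableSet_Ici
  refine hint.mono' ((by fun_prop : Measurable fun u ↦ Real.exp (-σ * u)).smul
    (measurable_shortSum a δ)).aestronglyMeasurable (ae_of_all _ fun u ↦ ?_)
  by_cases hu : u < -δ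
  · rw [shortSum_eq_zero hδ hu, indicator_of_notMem (by simpa using hu)]
    simp
  · rw [indicator_of_mem (by simpa using hu), norm_smul, mul_comm,
      Real.norm_of_nonneg (Real.exp_pos _).le]
    gcongr
    exact norm_shortSum_le hB δ u

theorem memLp_two_exp_smul_shortSum (hB : ∀ n, ‖∑ k ∈ Finset.Icc 1 n, a k‖ ≤ B)
    {σ δ : ℝ} (hσ : 0 < σ) (hδ : 0 ≤ δ) :
    MemLp (fun u ↦ Real.exp (-σ * u) • shortSum a δ u) 2 := by
  rw [memLp_two_iff_integrable_sq_norm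
    (integrable_exp_smul_shortSum hB hσ hδ).aestronglyMeasurable]
  have hint := (integrable_exp_smul_shortSum hB (mul_pos two_pos hσ) hδ).norm.const_mul (2 * B)
  refine hint.mono' ((integrable_exp_smul_shortSum hB hσ hδ).aestronglyMeasurable.norm.pow 2)
    (ae_of_all _ fun u ↦ ?_)
  rw [Real.norm_of_nonneg (sq_nonneg _), norm_exp_smul_shortSum_sq, norm_smul,
    Real.norm_of_nonneg (Real.exp_pos _).le, sq, mul_left_comm]
  gcongr
  exact norm_shortSum_le hB δ u

/-- Pointwise majorant of the weighted square of a short sum: single terms for `exp u` up to `M`,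
and the trivial bound beyond. -/
theorem norm_exp_smul_shortSum_sq_le (ha : ∀ n, ‖a n‖ ≤ 1)
    (hB : ∀ n, ‖∑ k ∈ Finset.Icc 1 n, a k‖ ≤ B) {σ δ : ℝ} (hσ : 1 / 2 ≤ σ) (hσ' : σ ≤ 2)
    (hδ : 0 ≤ δ) (hδ' : δ ≤ 1) {M : ℕ} (hM : 2 ≤ M) (u : ℝ) :
    ‖Real.exp (-σ * u) • shortSum a δ u‖ ^ 2 ≤
      2 * B * Real.exp 4 * (∑ n ∈ Finset.Icc 1 M,
        (Ico (Real.log n - δ) (Real.log n)).indicator (fun _ ↦ (n : ℝ)⁻¹) u) +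
      4 * B ^ 2 * (Ici (Real.log (M + 1) - 1)).indicator (fun u ↦ Real.exp (-u)) u := by
  have hB0 : 0 ≤ B := (norm_nonneg _).trans (hB 0)
  have hlog : 1 ≤ Real.log (M + 1) := by
    rw [Real.le_log_iff_exp_le (by positivity)]
    have : (2 : ℝ) ≤ M := by exact_mod_cast hM
    linarith [Real.exp_one_lt_three]
  rw [norm_exp_smul_shortSum_sq]
  have hS := norm_shortSum_le hB δ u
  by_cases hu : u + δ < Real.log (M + 1)
  · refine le_add_of_le_of_nonneg ?_
      (mul_nonneg (by positivity) (indicator_nonneg (fun _ _ ↦ (Real.exp_pos _).le) _))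
    calc Real.exp (-(2 * σ) * u) * ‖shortSum a δ u‖ ^ 2
        ≤ Real.exp (-(2 * σ) * u) * (2 * B * ∑ n ∈ Finset.Icc 1 M,
          (Ico (Real.log n - δ) (Real.log n)).indicator (fun _ ↦ (1 : ℝ)) u) := by
          rw [sq]
          gcongr
          exact norm_shortSum_le_sum ha hδ hu
      _ = 2 * B * ∑ n ∈ Finset.Icc 1 M, Real.exp (-(2 * σ) * u) *
          (Ico (Real.log n - δ) (Real.log n)).indicator (fun _ ↦ (1 : ℝ)) u := by
          rw [← Finset.mul_sum]; ring
      _ ≤ 2 * B * ∑ n ∈ Finset.Icc 1 M, Real.exp 4 *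
          (Ico (Real.log n - δ) (Real.log n)).indicator (fun _ ↦ (n : ℝ)⁻¹) u := by
          refine mul_le_mul_of_nonneg_left (Finset.sum_le_sum fun n hn ↦ ?_) (by positivity)
          have hn1 : (1 : ℝ) ≤ n := by exact_mod_cast (Finset.mem_Icc.mp hn).1
          have hlogn : 0 ≤ Real.log n := Real.log_nonneg hn1
          by_cases hmem : u ∈ Ico (Real.log n - δ) (Real.log n)
          · rw [indicator_of_mem hmem, indicator_of_mem hmem, mul_one,
              ← Real.exp_log (inv_pos.mpr (one_pos.trans_le hn1)), Real.log_inv, ← Real.exp_add,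
              Real.exp_le_exp]
            nlinarith [hmem.1]
          · simp [indicator_of_notMem hmem]
      _ = _ := by rw [← Finset.mul_sum]; ring
  · push Not at hu
    refine le_add_of_nonneg_of_le (mul_nonneg (by positivity)
      (Finset.sum_nonneg fun n _ ↦ indicator_nonneg (fun _ _ ↦ by positivity) _)) ?_
    rw [indicator_of_mem (show u ∈ Ici (Real.log (M + 1) - 1) by simp only [mem_Ici]; linarith),
      mul_comm]
    have h4 : ‖shortSum a δ u‖ ^ 2 ≤ 4 * B ^ 2 := by
      nlinarith [norm_nonneg (shortSum a δ u)]
    gcongr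
    nlinarith

theorem integral_norm_exp_smul_shortSum_sq_le (ha : ∀ n, ‖a n‖ ≤ 1)
    (hB : ∀ n, ‖∑ k ∈ Finset.Icc 1 n, a k‖ ≤ B) {σ : ℝ} (hσ : 1 / 2 ≤ σ) (hσ' : σ ≤ 2)
    {M : ℕ} (hM : 2 ≤ M) :
    ∫ u, ‖Real.exp (-σ * u) • shortSum a (M : ℝ)⁻¹ u‖ ^ 2 ≤
      (2 * B * Real.exp 4 + 4 * B ^ 2 * Real.exp 1) * (1 + Real.log M) / M := by
  have hM0 : (2 : ℝ) ≤ M := by exact_mod_cast hM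
  set δ := (M : ℝ)⁻¹ with hδdef
  have hδ : 0 ≤ δ := by positivity
  have hδ' : δ ≤ 1 := inv_le_one_of_one_le₀ (by linarith)
  have hB0 : 0 ≤ B := (norm_nonneg _).trans (hB 0)
  have hI (n : ℕ) : Integrable
      ((Ico (Real.log n - δ) (Real.log n)).indicator (fun _ ↦ (n : ℝ)⁻¹)) :=
    (integrableOn_const (by simp)).integrable_indicator measurableSet_Ico
  have hI1 : Integrable fun u ↦ ∑ n ∈ Finset.Icc 1 M,
      (Ico (Real.log n - δ) (Real.log n)).indicator (fun _ ↦ (n : ℝ)⁻¹) u :=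
    integrable_finsetSum _ fun n _ ↦ hI n
  have hI2 : Integrable ((Ici (Real.log (M + 1) - 1)).indicator fun u ↦ Real.exp (-u)) :=
    (((integrableOn_Ici_iff_integrableOn_Ioi enorm_ne_top).mpr
      (integrableOn_exp_neg_Ioi _))).integrable_indicator measurableSet_Ici
  have hv1 : ∫ u, ∑ n ∈ Finset.Icc 1 M,
      (Ico (Real.log n - δ) (Real.log n)).indicator (fun _ ↦ (n : ℝ)⁻¹) u
        = δ * harmonic M := by
    rw [integral_finsetSum _ fun n _ ↦ hI n, harmonic_eq_sum_Icc, Rat.cast_sum, Finset.mul_sum]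
    refine Finset.sum_congr rfl fun n _ ↦ ?_
    rw [integral_indicator measurableSet_Ico, setIntegral_const]
    simp [measureReal_def, hδ]
  have hv2 : ∫ u, (Ici (Real.log (M + 1) - 1)).indicator (fun u ↦ Real.exp (-u)) u
      = Real.exp 1 / (M + 1) := by
    rw [integral_indicator measurableSet_Ici, integral_Ici_eq_integral_Ioi, integral_exp_neg_Ioi,
      neg_sub, Real.exp_sub, Real.exp_log (by positivity)]
  have hlog : 0 ≤ Real.log M := Real.log_nonneg (by linarith)
  calc ∫ u, ‖Real.exp (-σ * u) • shortSum a δ u‖ ^ 2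
      ≤ ∫ u, (2 * B * Real.exp 4 * (∑ n ∈ Finset.Icc 1 M,
        (Ico (Real.log n - δ) (Real.log n)).indicator (fun _ ↦ (n : ℝ)⁻¹) u) +
      4 * B ^ 2 * (Ici (Real.log (M + 1) - 1)).indicator (fun u ↦ Real.exp (-u)) u) :=
        integral_mono_of_nonneg (ae_of_all _ fun _ ↦ sq_nonneg _)
          ((hI1.const_mul _).add (hI2.const_mul _))
          (ae_of_all _ (norm_exp_smul_shortSum_sq_le ha hB hσ hσ' hδ hδ' hM))
    _ = 2 * B * Real.exp 4 * (δ * harmonic M) + 4 * B ^ 2 * (Real.exp 1 / (M + 1)) := by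
        rw [integral_add (hI1.const_mul _) (hI2.const_mul _), integral_const_mul,
          integral_const_mul, hv1, hv2]
    _ ≤ 2 * B * Real.exp 4 * (δ * (1 + Real.log M)) +
        4 * B ^ 2 * (Real.exp 1 * (1 + Real.log M) / M) := by
        gcongr
        · exact harmonic_le_one_add_log M
        · exact le_mul_of_one_le_right (Real.exp_pos _).le (by linarith)
        · linarith
    _ = _ := by rw [hδdef]; field_simp

end ShortSums

section MeanSquare

open MeasureTheory Set FourierTransform

theorem mul_mellin_eq_fourier_shortSum {a : ℕ → ℂ} {B : ℝ}
    (hB : ∀ n, ‖∑ k ∈ Finset.Icc 1 n, a k‖ ≤ B) {s : ℂ} (hs : 0 < s.re) (δ : ℝ) :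
    (cexp (δ * s) - 1) * mellin (fun x : ℝ ↦ ∑ k ∈ Finset.Icc 1 ⌊x⁻¹⌋₊, a k) s =
      𝓕 (fun u : ℝ ↦ Real.exp (-s.re * u) • shortSum a δ u) (s.im / (2 * Real.pi)) := by
  set F : ℝ → ℂ := fun x ↦ ∑ k ∈ Finset.Icc 1 ⌊x⁻¹⌋₊, a k with hF
  have hconv : MellinConvergent F s := mellinConvergent_sum_Icc_floor_inv hB hs
  have hsub := (hasMellin_sub ((MellinConvergent.comp_mul_left (Real.exp_pos (-δ))).mpr hconv)
    hconv).2
  rw [mellin_comp_mul_left _ _ (Real.exp_pos _), mellin_eq_fourier] at hsub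
  have hpow : ((Real.exp (-δ) : ℝ) : ℂ) ^ (-s) = cexp (δ * s) := by
    rw [cpow_def_of_ne_zero (by exact_mod_cast (Real.exp_pos _).ne'), ← ofReal_log
      (Real.exp_pos _).le, Real.log_exp]
    push_cast
    ring_nf
  rw [hpow, smul_eq_mul] at hsub
  rw [sub_one_mul, ← hsub]
  refine congrArg (fun g : ℝ → ℂ ↦ 𝓕 g (s.im / (2 * Real.pi))) (funext fun u ↦ ?_)
  simp only [hF, shortSum, ← Real.exp_add, ← Real.exp_neg]
  ring_nf

theorem half_norm_le_norm_exp_sub_one {w : ℂ} (hw : ‖w‖ ≤ 1 / 2) : ‖w‖ / 2 ≤ ‖cexp w - 1‖ := by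
  have h1 := norm_exp_sub_one_sub_id_le (hw.trans (by norm_num))
  have h2 : ‖w‖ ≤ ‖cexp w - 1‖ + ‖cexp w - 1 - w‖ := by
    simpa using norm_sub_le (cexp w - 1) (cexp w - 1 - w)
  nlinarith [norm_nonneg w]

namespace DirichletCharacter

variable {q : ℕ} [NeZero q] {χ : DirichletCharacter ℂ q}

theorem norm_LFunction_le_fourier_shortSum (hχ : χ ≠ 1) {s : ℂ} (hs : 0 < s.re) {M : ℝ}
    (hM : 2 * ‖s‖ ≤ M) :
    ‖LFunction χ s‖ ≤ 2 * M *
      ‖𝓕 (fun u : ℝ ↦ Real.exp (-s.re * u) • shortSum (fun n ↦ χ n) M⁻¹ u)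
        (s.im / (2 * Real.pi))‖ := by
  have hs0 : 0 < ‖s‖ := norm_pos_iff.mpr fun h ↦ by simp [h] at hs
  have hM0 : 0 < M := by linarith
  rw [← mul_mellin_eq_fourier_shortSum (norm_sum_Icc_le hχ) hs, LFunction_eq_mul_mellin hχ hs,
    norm_mul, norm_mul]
  have hnorm : ‖((M⁻¹ : ℝ) : ℂ) * s‖ = ‖s‖ / M := by
    rw [norm_mul, norm_real, Real.norm_of_nonneg (by positivity)]
    ring
  have hle := half_norm_le_norm_exp_sub_one (w := ((M⁻¹ : ℝ) : ℂ) * s)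
    (by rw [hnorm, div_le_div_iff₀ hM0 two_pos]; linarith)
  rw [hnorm] at hle
  have hle' : ‖s‖ ≤ 2 * M * ‖cexp (((M⁻¹ : ℝ) : ℂ) * s) - 1‖ := by
    rw [div_div, div_le_iff₀ (by positivity)] at hle
    linarith
  rw [← mul_assoc]
  gcongr

theorem continuous_LFunction_vertical (hχ : χ ≠ 1) (σ : ℝ) :
    Continuous fun t : ℝ ↦ LFunction χ (σ + t * I) :=
  (differentiable_LFunction hχ).continuous.comp (by fun_prop)

/-- The mean square of `L(s, χ)` over `|t| ≤ N` is `O(N log N)`, uniformly for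
`1 / 2 ≤ σ ≤ 2`. -/
theorem exists_integral_norm_LFunction_sq_le (hχ : χ ≠ 1) :
    ∃ C > 0, ∀ σ : ℝ, 1 / 2 ≤ σ → σ ≤ 2 → ∀ N : ℕ, 2 ≤ N →
      ∫ t in (-N : ℝ)..N, ‖LFunction χ (σ + t * I)‖ ^ 2 ≤ C * N * (1 + Real.log N) := by
  set B : ℝ := q + 1
  set K : ℝ := 2 * B * Real.exp 4 + 4 * B ^ 2 * Real.exp 1
  have hB := norm_sum_Icc_le hχ
  refine ⟨8 * Real.pi * K * 4 * 3, by positivity, fun σ hσ hσ' N hN ↦ ?_⟩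
  have hN' : (2 : ℝ) ≤ N := by exact_mod_cast hN
  have hσ0 : 0 < σ := by linarith
  set M : ℕ := 4 * N with hM
  have hM' : (M : ℝ) = 4 * N := by simp [hM]
  set φ : ℝ → ℂ := fun u ↦ Real.exp (-σ * u) • shortSum (fun n ↦ χ n) (M : ℝ)⁻¹ u
  have hφ : Integrable φ := integrable_exp_smul_shortSum hB hσ0 (by positivity)
  have hφ2 : MemLp φ 2 := memLp_two_exp_smul_shortSum hB hσ0 (by positivity)
  have hint : Integrable fun t : ℝ ↦ (2 * (M : ℝ)) ^ 2 * ‖𝓕 φ (t / (2 * Real.pi))‖ ^ 2 :=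
    (((memLp_fourier hφ hφ2).integrable_norm_pow two_ne_zero).comp_div
      (by positivity)).const_mul _
  have hlog : Real.log M ≤ 2 + Real.log N := by
    rw [hM', Real.log_mul (by norm_num) (by positivity)]
    have : Real.log 4 ≤ 2 := by
      rw [show (4 : ℝ) = 2 ^ 2 by norm_num, Real.log_pow]
      push_cast
      linarith [Real.log_two_lt_d9]
    linarith
  have hlogN : 0 ≤ Real.log N := Real.log_nonneg (by linarith)
  have hcont : Continuous fun t : ℝ ↦ ‖LFunction χ (σ + t * I)‖ ^ 2 :=
    (continuous_LFunction_vertical hχ σ).norm.pow 2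
  calc ∫ t in (-N : ℝ)..N, ‖LFunction χ (σ + t * I)‖ ^ 2
      ≤ ∫ t in (-N : ℝ)..N, (2 * (M : ℝ)) ^ 2 * ‖𝓕 φ (t / (2 * Real.pi))‖ ^ 2 := by
        refine intervalIntegral.integral_mono_on (by linarith)
          (hcont.intervalIntegrable _ _) hint.intervalIntegrable fun t ht ↦ ?_
        have hnorm : ‖(σ : ℂ) + t * I‖ ≤ 2 + N := by
          refine (norm_add_le _ _).trans (add_le_add ?_ ?_)
          · simpa [abs_of_pos hσ0] using hσ'
          · simpa [abs_le] using ht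
        have h := norm_LFunction_le_fourier_shortSum hχ (s := σ + t * I) (by simpa using hσ0)
          (M := M) (by linarith)
        rw [← mul_pow]
        gcongr
        rwa [show ((σ : ℂ) + t * I).re = σ by simp, show ((σ : ℂ) + t * I).im = t by simp] at h
    _ ≤ ∫ t, (2 * (M : ℝ)) ^ 2 * ‖𝓕 φ (t / (2 * Real.pi))‖ ^ 2 := by
        rw [intervalIntegral.integral_of_le (by linarith)]
        exact setIntegral_le_integral hint (ae_of_all _ fun _ ↦ by positivity)
    _ = (2 * (M : ℝ)) ^ 2 * (2 * Real.pi * ∫ u, ‖φ u‖ ^ 2) := by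
        rw [integral_const_mul, Measure.integral_comp_div (fun x ↦ ‖𝓕 φ x‖ ^ 2),
          integral_norm_sq_fourier hφ hφ2, abs_of_pos (by positivity), smul_eq_mul]
    _ ≤ (2 * (M : ℝ)) ^ 2 * (2 * Real.pi * (K * (1 + Real.log M) / M)) := by
        gcongr
        exact integral_norm_exp_smul_shortSum_sq_le (fun n ↦ norm_le_one χ _) hB hσ hσ' (by lia)
    _ = 8 * Real.pi * K * M * (1 + Real.log M) := by
        field_simp
        ring
    _ ≤ 8 * Real.pi * K * (4 * N) * (3 * (1 + Real.log N)) := by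
        rw [hM'] at hlog ⊢
        gcongr
        linarith
    _ = _ := by ring

end DirichletCharacter

/-- If the integrals of `f` over `[-2 ^ k, 2 ^ k]` are at most `A * 2 ^ k * k`, then the weight
`w t ≤ 1 / |t|` turns this into a bound `O(A * k ^ 2)`. -/
theorem integral_mul_le_of_dyadic {f w : ℝ → ℝ} (hf : Continuous f) (hw : Continuous w)
    (hf0 : ∀ t, 0 ≤ f t) (hw2 : ∀ t, w t ≤ 2) (hwt : ∀ t, w t * |t| ≤ 1) {A : ℝ} (hA : 0 ≤ A)
    (h : ∀ k : ℕ, 1 ≤ k → ∫ t in (-2 ^ k : ℝ)..2 ^ k, f t ≤ A * 2 ^ k * k) {k : ℕ} (hk : 1 ≤ k) :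
    ∫ t in (-2 ^ k : ℝ)..2 ^ k, f t * w t ≤ 4 * A * k ^ 2 := by
  have hfi (x y : ℝ) : IntervalIntegrable f volume x y := hf.intervalIntegrable x y
  have hfwi (x y : ℝ) : IntervalIntegrable (fun t ↦ f t * w t) volume x y :=
    (hf.mul hw).intervalIntegrable x y
  have split {g : ℝ → ℝ} (hg : ∀ x y, IntervalIntegrable g volume x y) (k : ℕ) :
      ∫ t in (-2 ^ (k + 1) : ℝ)..2 ^ (k + 1), g t =
        (∫ t in (-2 ^ (k + 1) : ℝ)..(-2 ^ k), g t) + (∫ t in (-2 ^ k : ℝ)..2 ^ k, g t) +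
          ∫ t in (2 ^ k : ℝ)..2 ^ (k + 1), g t := by
    rw [intervalIntegral.integral_add_adjacent_intervals (hg _ _) (hg _ _),
      intervalIntegral.integral_add_adjacent_intervals (hg _ _) (hg _ _)]
  induction k, hk using Nat.le_induction with
  | base =>
    calc ∫ t in (-2 ^ 1 : ℝ)..2 ^ 1, f t * w t ≤ ∫ t in (-2 ^ 1 : ℝ)..2 ^ 1, f t * 2 :=
          intervalIntegral.integral_mono (by norm_num) (hfwi _ _) ((hfi _ _).mul_const 2)
            fun t ↦ mul_le_mul_of_nonneg_left (hw2 t) (hf0 t)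
      _ ≤ _ := by
          rw [intervalIntegral.integral_mul_const]
          have := h 1 le_rfl
          push_cast at this ⊢
          linarith
  | succ k hk ih =>
    have hpow : (0 : ℝ) < 2 ^ k := by positivity
    have hsucc : (2 : ℝ) ^ (k + 1) = 2 * 2 ^ k := by ring
    have outer {x y : ℝ} (hxy : x ≤ y) (hout : ∀ t ∈ Icc x y, 2 ^ k ≤ |t|) :
        ∫ t in x..y, f t * w t ≤ (∫ t in x..y, f t) * (2 ^ k)⁻¹ := by
      rw [← intervalIntegral.integral_mul_const]
      refine intervalIntegral.integral_mono_on hxy (hfwi _ _) ((hfi _ _).mul_const _)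
        fun t ht ↦ mul_le_mul_of_nonneg_left ?_ (hf0 t)
      have ht0 := hout t ht
      calc w t ≤ 1 / |t| := by
            rw [le_div_iff₀ (hpow.trans_le ht0)]
            exact hwt t
        _ ≤ (2 ^ k)⁻¹ := by
            rw [one_div]
            gcongr
    have h1 := outer (x := -2 ^ (k + 1)) (y := -2 ^ k) (by linarith)
      fun t ht ↦ le_abs.mpr (Or.inr (by linarith [ht.2]))
    have h2 := outer (x := 2 ^ k) (y := 2 ^ (k + 1)) (by linarith)
      fun t ht ↦ le_abs.mpr (Or.inl ht.1)
    have hmid : 0 ≤ ∫ t in (-2 ^ k : ℝ)..2 ^ k, f t :=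
      intervalIntegral.integral_nonneg (by linarith) fun t _ ↦ hf0 t
    have htot := h (k + 1) (by lia)
    rw [split hfi] at htot
    have hsum : ((∫ t in (-2 ^ (k + 1) : ℝ)..(-2 ^ k), f t) +
        ∫ t in (2 ^ k : ℝ)..2 ^ (k + 1), f t) * (2 ^ k)⁻¹ ≤ 2 * A * (k + 1) := by
      rw [← div_eq_mul_inv, div_le_iff₀ hpow]
      push_cast at htot
      rw [hsucc] at htot ⊢
      linarith
    rw [split hfwi]
    push_cast
    nlinarith [mul_nonneg hA (Nat.cast_nonneg (α := ℝ) k)]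

end MeanSquare

/-- Unconditionally, uniformly for `1/2 ≤ σ ≤ 2` and `T ≥ 2`,
`∫_{-T}^{T} |L(σ+it,χ)|² / |σ+it| dt ≪_q (log T)²`. -/
theorem stmt10 (q : ℕ) [NeZero q] (hq : 3 ≤ q) (χ : DirichletCharacter ℂ q)
    (hχ : χ ≠ 1) (hχreal : ∀ n : ZMod q, (χ n).im = 0) :
    ∃ C > 0, ∀ σ T : ℝ, 1/2 ≤ σ → σ ≤ 2 → 2 ≤ T →
      (∫ t in (-T)..T,
          ‖DirichletCharacter.LFunction χ ((σ : ℂ) + (t : ℂ) * I)‖ ^ 2 /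
            ‖(σ : ℂ) + (t : ℂ) * I‖) ≤ C * Real.log T ^ 2 := by
  obtain ⟨C, hC, hmean⟩ := DirichletCharacter.exists_integral_norm_LFunction_sq_le hχ
  refine ⟨4 * (2 * C) * 16, by positivity, fun σ T hσ hσ' hT ↦ ?_⟩
  have hlogT : Real.log 2 ≤ Real.log T := Real.log_le_log two_pos hT
  have hlog2 : 1 / 2 < Real.log 2 := by linarith [Real.log_two_gt_d9]
  have hnorm (t : ℝ) : 1 / 2 ≤ ‖(σ : ℂ) + t * I‖ :=
    hσ.trans (by simpa using re_le_norm ((σ : ℂ) + t * I))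
  have hpos (t : ℝ) : 0 < ‖(σ : ℂ) + t * I‖ := one_half_pos.trans_le (hnorm t)
  have hf : Continuous fun t : ℝ ↦ ‖DirichletCharacter.LFunction χ (σ + t * I)‖ ^ 2 :=
    (DirichletCharacter.continuous_LFunction_vertical hχ σ).norm.pow 2
  have hw : Continuous fun t : ℝ ↦ ‖(σ : ℂ) + t * I‖⁻¹ :=
    Continuous.inv₀ (by fun_prop) fun t ↦ (hpos t).ne'
  simp only [div_eq_mul_inv]
  set k : ℕ := ⌈Real.logb 2 T⌉₊
  have hlogb : 1 ≤ Real.logb 2 T := by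
    rw [Real.le_logb_iff_rpow_le one_lt_two (by linarith)]
    simpa using hT
  have hk : 1 ≤ k := Nat.one_le_ceil_iff.mpr (by linarith)
  have hTk : T ≤ 2 ^ k := by
    rw [← Real.rpow_natCast, ← Real.logb_le_iff_le_rpow one_lt_two (by linarith)]
    exact Nat.le_ceil _
  have hkT : (k : ℝ) ≤ 4 * Real.log T := by
    have h1 : (k : ℝ) < Real.logb 2 T + 1 := Nat.ceil_lt_add_one (by linarith)
    have h2 : Real.logb 2 T ≤ 2 * Real.log T := by
      rw [Real.logb, div_le_iff₀ (by linarith)]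
      nlinarith
    linarith
  calc ∫ t in (-T)..T, ‖DirichletCharacter.LFunction χ (σ + t * I)‖ ^ 2 * ‖(σ : ℂ) + t * I‖⁻¹
      ≤ ∫ t in (-2 ^ k : ℝ)..2 ^ k,
          ‖DirichletCharacter.LFunction χ (σ + t * I)‖ ^ 2 * ‖(σ : ℂ) + t * I‖⁻¹ :=
        intervalIntegral.integral_mono_interval (by linarith) (by linarith) hTk
          (Filter.Eventually.of_forall fun t ↦ by positivity) ((hf.mul hw).intervalIntegrable _ _)
    _ ≤ 4 * (2 * C) * k ^ 2 := by
        refine integral_mul_le_of_dyadic hf hw (fun t ↦ by positivity) (fun t ↦ ?_) (fun t ↦ ?_)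
          (by positivity) (fun j hj ↦ ?_) hk
        · exact inv_le_of_inv_le₀ two_pos (by simpa using hnorm t)
        · rw [inv_mul_le_iff₀ (hpos t), mul_one]
          simpa using abs_im_le_norm ((σ : ℂ) + t * I)
        · have h := hmean σ hσ hσ' (2 ^ j) (Nat.le_self_pow (by lia) 2)
          have hj' : (1 : ℝ) ≤ j := by exact_mod_cast hj
          push_cast at h
          rw [Real.log_pow] at h
          refine h.trans ?_
          rw [show 2 * C * 2 ^ j * (j : ℝ) = C * 2 ^ j * (2 * j) by ring]
          gcongr
          nlinarith [Real.log_two_lt_d9]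
    _ ≤ 4 * (2 * C) * (4 * Real.log T) ^ 2 := by gcongr
    _ = _ := by ring
end

section
/- Assume the Riemann Hypothesis: all non-trivial zeros of the Riemann zeta-function lie on the line Re s = 1/2. Then for every ε > 0 and every real t with |t| ≥ 2, one has 1/|ζ(it)| ≪_ε |t|^{ε − 1/2}; equivalently, |ζ(it)| ≫_ε |t|^{1/2 − ε} for purely imaginary arguments it with |t| ≥ 2. -/
open Complex

open Filter Topology

/-- The Euler–Maclaurin main term for `ζ(s)`: the first `M` terms of the Dirichlet series and the
integral approximating the tail. -/
noncomputable def zetaApprox (M : ℕ) (s : ℂ) : ℂ :=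
  ∑ n ∈ Finset.range M, ((n + 1 : ℝ) : ℂ) ^ (-s) + ((M + 1 : ℝ) : ℂ) ^ (1 - s) / (s - 1)

lemma norm_cpow_neg_sub_cpow_neg_le {s : ℂ} (hs : 1 ≤ s.re) {x y : ℝ} (hx : 1 ≤ x)
    (hxy : x ≤ y) (hy : y ≤ x + 1) :
    ‖(y : ℂ) ^ (-s) - (x : ℂ) ^ (-s)‖ ≤ ‖s‖ * x ^ (-2 : ℝ) := by
  have hs0 : -s ≠ 0 := by
    intro h
    have := congrArg re h
    simp at this
    linarith
  have key := Convex.norm_image_sub_le_of_norm_hasDerivWithin_le (𝕜 := ℝ)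
    (f := fun u : ℝ => (u : ℂ) ^ (-s)) (f' := fun u : ℝ => (-s) * (u : ℂ) ^ (-s - 1))
    (s := Set.Icc x (x + 1)) (x := x) (y := y) (C := ‖s‖ * x ^ (-2 : ℝ))
    (fun u hu => (hasDerivAt_ofReal_cpow_const (by linarith [hu.1]) hs0).hasDerivWithinAt)
    (fun u hu => by
      have hu0 : 0 < u := by linarith [hu.1]
      rw [norm_mul, norm_neg, norm_cpow_eq_rpow_re_of_pos hu0]
      gcongr
      calc u ^ (-s - 1).re ≤ u ^ (-2 : ℝ) :=
            Real.rpow_le_rpow_of_exponent_le (by linarith [hu.1]) (by simp; linarith)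
        _ ≤ x ^ (-2 : ℝ) :=
            Real.rpow_le_rpow_of_nonpos (by linarith) hu.1 (by norm_num))
    (convex_Icc _ _) ⟨le_rfl, by linarith⟩ ⟨hxy, hy⟩
  refine key.trans ?_
  have h1 : ‖y - x‖ ≤ 1 := by
    rw [Real.norm_eq_abs, abs_le]; constructor <;> linarith
  exact mul_le_of_le_one_right (by positivity) h1

lemma norm_cpow_neg_add_sub_le {s : ℂ} (hs : 1 ≤ s.re) (hs1 : s ≠ 1) {x : ℝ} (hx : 1 ≤ x) :
    ‖(x : ℂ) ^ (-s) + ((x + 1 : ℝ) : ℂ) ^ (1 - s) / (s - 1) - (x : ℂ) ^ (1 - s) / (s - 1)‖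
      ≤ 2 * ‖s‖ * (1 / x - 1 / (x + 1)) := by
  have hs1' : s - 1 ≠ 0 := sub_ne_zero.2 hs1
  have hs2 : 1 - s ≠ 0 := sub_ne_zero.2 hs1.symm
  have key := Convex.norm_image_sub_le_of_norm_hasDerivWithin_le (𝕜 := ℝ)
    (f := fun u : ℝ => (u : ℂ) * (x : ℂ) ^ (-s) + (u : ℂ) ^ (1 - s) / (s - 1))
    (f' := fun u : ℝ => -((u : ℂ) ^ (-s) - (x : ℂ) ^ (-s)))
    (s := Set.Icc x (x + 1)) (x := x) (y := x + 1) (C := ‖s‖ * x ^ (-2 : ℝ))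
    (fun u hu => by
      have hu0 : u ≠ 0 := by linarith [hu.1]
      have h1 := ((hasDerivAt_ofReal_cpow_const hu0 hs2).div_const (s - 1))
      have h2 := (HasDerivAt.ofReal_comp (hasDerivAt_id u)).mul_const ((x : ℂ) ^ (-s))
      refine (h2.add h1).hasDerivWithinAt.congr_deriv ?_
      rw [show 1 - s - 1 = -s by ring]
      field_simp
      simp
      ring)
    (fun u hu => by
      rw [norm_neg]
      exact norm_cpow_neg_sub_cpow_neg_le hs hx hu.1 hu.2)
    (convex_Icc _ _) ⟨le_rfl, by linarith⟩ ⟨by linarith, le_rfl⟩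
  have e1 : (x : ℂ) ^ (-s) + ((x + 1 : ℝ) : ℂ) ^ (1 - s) / (s - 1) - (x : ℂ) ^ (1 - s) / (s - 1)
      = ((x + 1 : ℝ) : ℂ) * (x : ℂ) ^ (-s) + ((x + 1 : ℝ) : ℂ) ^ (1 - s) / (s - 1)
        - ((x : ℂ) * (x : ℂ) ^ (-s) + (x : ℂ) ^ (1 - s) / (s - 1)) := by
    push_cast; ring
  rw [e1]
  refine key.trans ?_
  have hx0 : 0 < x := by linarith
  have e2 : x ^ (-2 : ℝ) ≤ 2 * (1 / x - 1 / (x + 1)) := by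
    rw [Real.rpow_neg hx0.le, Real.rpow_ofNat, div_sub_div _ _ hx0.ne' (by linarith),
      inv_eq_one_div, mul_div_assoc', div_le_div_iff₀ (by positivity) (by positivity)]
    nlinarith
  calc ‖s‖ * x ^ (-2 : ℝ) * ‖x + 1 - x‖ = ‖s‖ * x ^ (-2 : ℝ) := by simp
    _ ≤ ‖s‖ * (2 * (1 / x - 1 / (x + 1))) := by gcongr
    _ = _ := by ring

lemma norm_zetaApprox_add_sub_le {s : ℂ} (hs : 1 ≤ s.re) (hs1 : s ≠ 1) (M k : ℕ) :
    ‖zetaApprox (M + k) s - zetaApprox M s‖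
      ≤ 2 * ‖s‖ * (1 / (M + 1 : ℝ) - 1 / ((M + k : ℕ) + 1 : ℝ)) := by
  induction k with
  | zero => simp
  | succ k ih =>
    have h := norm_cpow_neg_add_sub_le hs hs1 (x := ((M + k : ℕ) : ℝ) + 1)
      (by linarith [Nat.cast_nonneg (α := ℝ) (M + k)])
    have e : zetaApprox (M + (k + 1)) s - zetaApprox M s
        = ((((((M + k : ℕ) : ℝ) + 1 : ℝ)) : ℂ) ^ (-s)
          + ((((M + k : ℕ) : ℝ) + 1 + 1 : ℝ) : ℂ) ^ (1 - s) / (s - 1)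
          - ((((M + k : ℕ) : ℝ) + 1 : ℝ) : ℂ) ^ (1 - s) / (s - 1))
          + (zetaApprox (M + k) s - zetaApprox M s) := by
      rw [← add_assoc, zetaApprox, zetaApprox, zetaApprox, Finset.sum_range_succ]
      push_cast
      ring
    rw [e]
    refine (norm_add_le _ _).trans ((add_le_add h ih).trans (le_of_eq ?_))
    push_cast
    ring

lemma tendsto_zetaApprox {s : ℂ} (hs : 1 < s.re) :
    Tendsto (fun k => zetaApprox k s) atTop (𝓝 (riemannZeta s)) := by
  have hsum : Summable fun n : ℕ => 1 / (n + 1 : ℂ) ^ s := by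
    have := (summable_nat_add_iff 1).2 (Complex.summable_one_div_nat_cpow.2 hs)
    simpa using this
  have h1 := hsum.hasSum.tendsto_sum_nat
  rw [← zeta_eq_tsum_one_div_nat_add_one_cpow hs] at h1
  have h2 : Tendsto (fun k : ℕ => ((k + 1 : ℝ) : ℂ) ^ (1 - s) / (s - 1)) atTop (𝓝 0) := by
    rw [← zero_div (s - 1)]
    refine Tendsto.div_const ?_ _
    rw [tendsto_zero_iff_norm_tendsto_zero]
    have h3 : Tendsto (fun x : ℝ => x ^ (-(s.re - 1))) atTop (𝓝 0) :=
      tendsto_rpow_neg_atTop (by linarith)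
    have h4 := h3.comp (tendsto_atTop_add_const_right atTop (1 : ℝ)
      (tendsto_natCast_atTop_atTop (R := ℝ)))
    refine h4.congr fun k => ?_
    rw [norm_cpow_eq_rpow_re_of_pos (by positivity)]
    simp
  have h5 := h1.add h2
  rw [add_zero] at h5
  refine h5.congr fun k => ?_
  rw [zetaApprox]
  congr 1
  refine Finset.sum_congr rfl fun n _ => ?_
  rw [cpow_neg]
  simp

lemma norm_riemannZeta_sub_zetaApprox_le_of_one_lt {s : ℂ} (hs : 1 < s.re) (M : ℕ) :
    ‖riemannZeta s - zetaApprox M s‖ ≤ 2 * ‖s‖ / (M + 1) := by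
  have hs1 : s ≠ 1 := by rintro rfl; simp at hs
  have h := ((tendsto_zetaApprox hs).comp (tendsto_add_atTop_nat M)).sub_const (zetaApprox M s)
  refine le_of_tendsto h.norm (Eventually.of_forall fun k => ?_)
  have h2 := norm_zetaApprox_add_sub_le hs.le hs1 M k
  simp only [Function.comp_apply]
  rw [add_comm k M]
  refine h2.trans ?_
  rw [mul_div_assoc, div_eq_mul_one_div ‖s‖, ← mul_assoc]
  gcongr
  have : (0 : ℝ) ≤ 1 / ((M + k : ℕ) + 1 : ℝ) := by positivity
  linarith

lemma continuousAt_zetaApprox (M : ℕ) {s : ℂ} (hs1 : s ≠ 1) :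
    ContinuousAt (zetaApprox M) s := by
  have h : ∀ n : ℕ, ((n + 1 : ℝ) : ℂ) ≠ 0 := fun n => by
    exact_mod_cast (Nat.cast_add_one_pos (α := ℝ) n).ne'
  have hs1' : s - 1 ≠ 0 := sub_ne_zero.2 hs1
  unfold zetaApprox
  refine ContinuousAt.add (tendsto_finsetSum _ fun n _ => ?_) (ContinuousAt.div ?_ ?_ hs1')
  · exact ContinuousAt.const_cpow (by fun_prop) (Or.inl (h n))
  · exact ContinuousAt.const_cpow (by fun_prop) (Or.inl (h M))
  · fun_prop

lemma norm_riemannZeta_sub_zetaApprox_le {s : ℂ} (hs : 1 ≤ s.re) (hs1 : s ≠ 1) (M : ℕ) :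
    ‖riemannZeta s - zetaApprox M s‖ ≤ 2 * ‖s‖ / (M + 1) := by
  have hc : ContinuousAt (fun z => riemannZeta z - zetaApprox M z) s :=
    (differentiableAt_riemannZeta hs1).continuousAt.sub (continuousAt_zetaApprox M hs1)
  have hg : Tendsto (fun x : ℝ => s + (x : ℂ)) (𝓝[>] 0) (𝓝 s) := by
    have : ContinuousAt (fun x : ℝ => s + (x : ℂ)) 0 := by fun_prop
    have := this.tendsto
    simp only [ofReal_zero, add_zero] at this
    exact this.mono_left nhdsWithin_le_nhds
  have h1 := (hc.tendsto.comp hg).norm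
  have h2 := (hg.norm.const_mul 2).div_const (M + 1 : ℝ)
  refine le_of_tendsto_of_tendsto h1 h2 ?_
  filter_upwards [self_mem_nhdsWithin] with x hx
  refine norm_riemannZeta_sub_zetaApprox_le_of_one_lt ?_ M
  simp only [add_re, ofReal_re]
  have : 0 < x := hx
  linarith

lemma sum_range_one_div_le (M : ℕ) :
    ∑ n ∈ Finset.range M, 1 / (n + 1 : ℝ) ≤ 1 + Real.log (M + 1) := by
  have h := harmonic_le_one_add_log M
  have e : ((harmonic M : ℚ) : ℝ) = ∑ n ∈ Finset.range M, 1 / (n + 1 : ℝ) := by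
    simp [harmonic]
  rw [e] at h
  rcases Nat.eq_zero_or_pos M with rfl | hM
  · simp
  · refine h.trans ?_
    gcongr
    linarith

lemma norm_zetaApprox_le (M : ℕ) {s : ℂ} (hs : 1 ≤ s.re) :
    ‖zetaApprox M s‖ ≤ 1 + Real.log (M + 1) + 1 / ‖s - 1‖ := by
  refine (norm_add_le _ _).trans (add_le_add ((norm_sum_le _ _).trans
    (le_trans (Finset.sum_le_sum fun n _ => ?_) (sum_range_one_div_le M))) ?_)
  · rw [norm_cpow_eq_rpow_re_of_pos (by positivity), one_div, ← Real.rpow_neg_one]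
    exact Real.rpow_le_rpow_of_exponent_le (by linarith [Nat.cast_nonneg (α := ℝ) n])
      (by simpa using hs)
  · rw [norm_div, norm_cpow_eq_rpow_re_of_pos (by positivity)]
    gcongr
    exact Real.rpow_le_one_of_one_le_of_nonpos (by linarith [Nat.cast_nonneg (α := ℝ) M])
      (by simpa using hs)

lemma norm_cpow_neg_ofReal_sub_one_le {x η : ℝ} (hx : 1 ≤ x) (hη : 0 ≤ η) :
    ‖(x : ℂ) ^ (-(η : ℂ)) - 1‖ ≤ η * Real.log x := by
  have h0 : 0 < x := by linarith
  rw [← ofReal_neg, ← ofReal_cpow h0.le, ← ofReal_one, ← ofReal_sub, norm_real, Real.norm_eq_abs,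
    abs_sub_comm, abs_of_nonneg]
  · rw [Real.rpow_def_of_pos h0]
    have := Real.add_one_le_exp (Real.log x * -η)
    nlinarith
  · have := Real.rpow_le_one_of_one_le_of_nonpos hx (neg_nonpos.2 hη)
    linarith

lemma norm_zetaApprox_sub_le (M : ℕ) {t η : ℝ} (ht : 1 ≤ |t|) (hη : 0 ≤ η) :
    ‖zetaApprox M (1 + η + I * t) - zetaApprox M (1 + I * t)‖
      ≤ η * (1 + Real.log (M + 1)) ^ 2 := by
  set l := Real.log (M + 1) with hl
  have hl0 : 0 ≤ l := Real.log_nonneg (by linarith [Nat.cast_nonneg (α := ℝ) M])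
  have ht0 : t ≠ 0 := by rintro rfl; simp at ht; linarith
  have hIt : I * (t : ℂ) ≠ 0 := by simp [ht0]
  have hηt : (η : ℂ) + I * t ≠ 0 := by
    intro h
    have := congrArg im h
    simp at this
    exact ht0 this
  have hnηt : 1 ≤ ‖(η : ℂ) + I * t‖ := by
    have := abs_im_le_norm ((η : ℂ) + I * t)
    simp at this
    linarith
  have hnt : 1 ≤ ‖I * (t : ℂ)‖ := by simpa using ht
  have e : zetaApprox M (1 + η + I * t) - zetaApprox M (1 + I * t)
      = ∑ n ∈ Finset.range M, ((n + 1 : ℝ) : ℂ) ^ (-(1 + I * (t : ℂ)))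
          * (((n + 1 : ℝ) : ℂ) ^ (-(η : ℂ)) - 1)
        + ((M + 1 : ℝ) : ℂ) ^ (-(I * (t : ℂ)))
          * ((((M + 1 : ℝ) : ℂ) ^ (-(η : ℂ)) - 1) / (I * t)
            - ((M + 1 : ℝ) : ℂ) ^ (-(η : ℂ)) * (η / (I * t * (η + I * t)))) := by
    have hne : ∀ n : ℕ, ((n + 1 : ℝ) : ℂ) ≠ 0 := fun n => by
      exact_mod_cast (Nat.cast_add_one_pos (α := ℝ) n).ne'
    have e1 : ∀ n ∈ Finset.range M, ((n + 1 : ℝ) : ℂ) ^ (-(1 + I * (t : ℂ)))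
          * (((n + 1 : ℝ) : ℂ) ^ (-(η : ℂ)) - 1)
        = ((n + 1 : ℝ) : ℂ) ^ (-(1 + η + I * (t : ℂ))) - ((n + 1 : ℝ) : ℂ) ^ (-(1 + I * (t : ℂ))) := by
      intro n _
      rw [mul_sub, ← cpow_add _ _ (hne n), mul_one]
      ring_nf
    rw [Finset.sum_congr rfl e1, Finset.sum_sub_distrib, zetaApprox, zetaApprox,
      show 1 - (1 + (η : ℂ) + I * t) = -(I * t) + -(η : ℂ) by ring, cpow_add _ _ (hne M),
      show 1 - (1 + I * (t : ℂ)) = -(I * t) by ring,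
      show 1 + (η : ℂ) + I * t - 1 = η + I * t by ring, show 1 + I * (t : ℂ) - 1 = I * t by ring]
    have : (t : ℂ) ≠ 0 := by exact_mod_cast ht0
    field_simp
    ring
  rw [e]
  have b1 : ‖∑ n ∈ Finset.range M, ((n + 1 : ℝ) : ℂ) ^ (-(1 + I * (t : ℂ)))
          * (((n + 1 : ℝ) : ℂ) ^ (-(η : ℂ)) - 1)‖ ≤ (1 + l) * (η * l) := by
    refine (norm_sum_le _ _).trans (le_trans (Finset.sum_le_sum
      (g := fun n : ℕ => 1 / (n + 1 : ℝ) * (η * l)) fun n hn => ?_) ?_)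
    · have hn' : (n : ℝ) ≤ M := by exact_mod_cast (Finset.mem_range.1 hn).le
      rw [norm_mul, norm_cpow_eq_rpow_re_of_pos (by positivity), one_div, ← Real.rpow_neg_one]
      have h1 := norm_cpow_neg_ofReal_sub_one_le (x := n + 1)
        (by linarith [Nat.cast_nonneg (α := ℝ) n]) hη
      have h2 : Real.log (n + 1) ≤ l := Real.log_le_log (by positivity) (by linarith)
      have h3 : (-(1 + I * (t : ℂ))).re = -1 := by simp
      rw [h3]
      have h4 := h1.trans (mul_le_mul_of_nonneg_left h2 hη)
      gcongr
    · rw [← Finset.sum_mul]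
      have := sum_range_one_div_le M
      gcongr
  have b2 : ‖((M + 1 : ℝ) : ℂ) ^ (-(I * (t : ℂ)))
          * ((((M + 1 : ℝ) : ℂ) ^ (-(η : ℂ)) - 1) / (I * t)
            - ((M + 1 : ℝ) : ℂ) ^ (-(η : ℂ)) * (η / (I * t * (η + I * t))))‖ ≤ η * l + η := by
    have h1 := norm_cpow_neg_ofReal_sub_one_le (x := M + 1)
        (by linarith [Nat.cast_nonneg (α := ℝ) M]) hη
    rw [norm_mul, norm_cpow_eq_rpow_re_of_pos (by positivity)]
    have h3 : (-(I * (t : ℂ))).re = 0 := by simp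
    rw [h3, Real.rpow_zero, one_mul]
    refine (norm_sub_le _ _).trans (add_le_add ?_ ?_)
    · rw [norm_div]
      exact (div_le_self (norm_nonneg _) hnt).trans h1
    · rw [norm_mul, norm_cpow_eq_rpow_re_of_pos (by positivity), norm_div, norm_mul, norm_real,
        Real.norm_eq_abs, abs_of_nonneg hη]
      have h5 : (M + 1 : ℝ) ^ (-(η : ℂ)).re ≤ 1 :=
        Real.rpow_le_one_of_one_le_of_nonpos (by linarith [Nat.cast_nonneg (α := ℝ) M])
          (by simpa using hη)
      have h6 : η / (‖I * (t : ℂ)‖ * ‖(η : ℂ) + I * t‖) ≤ η :=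
        div_le_self hη (one_le_mul_of_one_le_of_one_le hnt hnηt)
      have h7 : 0 ≤ η / (‖I * (t : ℂ)‖ * ‖(η : ℂ) + I * t‖) := by positivity
      exact (mul_le_of_le_one_left h7 h5).trans h6
  refine (norm_add_le _ _).trans ((add_le_add b1 b2).trans (le_of_eq ?_))
  ring

lemma norm_riemannZeta_one_add_le {η : ℝ} (hη : 0 < η) (hη1 : η ≤ 1) :
    ‖riemannZeta (1 + η)‖ ≤ 5 / η := by
  have hne : (1 : ℂ) + η ≠ 1 := by simp [hη.ne']
  have h := norm_riemannZeta_sub_zetaApprox_le (s := 1 + η) (by simp [hη.le]) hne 0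
  have h2 : ‖zetaApprox 0 (1 + η)‖ ≤ 1 / η := by
    simp [zetaApprox, abs_of_pos hη]
  have h3 : ‖(1 : ℂ) + η‖ ≤ 2 := by
    refine (norm_add_le _ _).trans ?_
    simp [abs_of_pos hη]
    linarith
  have h4 : 1 ≤ 1 / η := by rw [le_div_iff₀ hη]; linarith
  have h5 := norm_le_norm_add_norm_sub' (riemannZeta (1 + η)) (zetaApprox 0 (1 + η))
  have h6 : (5 : ℝ) / η = 5 * (1 / η) := by ring
  norm_num at h
  linarith

/-- For `|t| ≥ 3`, a cutoff of size about `t²` gives an error `O(1/|t|)` and keeps the logarithm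
of the cutoff comparable with `log |t|`. -/
lemma exists_cutoff {T : ℝ} (hT : 3 ≤ T) :
    ∃ M : ℕ, T ^ 2 ≤ (M + 1 : ℝ) ∧ 1 + Real.log (M + 1) ≤ 4 * Real.log T := by
  have hL : 1 ≤ Real.log T := by
    rw [Real.le_log_iff_exp_le (by linarith)]
    linarith [Real.exp_one_lt_d9]
  refine ⟨⌈T ^ 2⌉₊, ?_, ?_⟩
  · linarith [Nat.le_ceil (T ^ 2)]
  · have h1 := Nat.ceil_lt_add_one (sq_nonneg T)
    have h2 : (⌈T ^ 2⌉₊ : ℝ) + 1 ≤ T ^ 3 := by nlinarith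
    have h3 := Real.log_le_log (by positivity) h2
    rw [Real.log_pow] at h3
    push_cast at h3
    linarith

lemma norm_riemannZeta_le_mul_log {t η : ℝ} (ht : 3 ≤ |t|) (hη : 0 ≤ η) (hη1 : η ≤ 1) :
    ‖riemannZeta (1 + η + 2 * I * t)‖ ≤ 7 * Real.log |t| := by
  have hL : 1 ≤ Real.log |t| := by
    rw [Real.le_log_iff_exp_le (by linarith)]
    linarith [Real.exp_one_lt_d9]
  obtain ⟨M, hM, hl⟩ := exists_cutoff ht
  have hre : (1 : ℝ) ≤ (1 + η + 2 * I * t : ℂ).re := by simp [hη]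
  have hn1 : 1 ≤ ‖(1 + η + 2 * I * t : ℂ) - 1‖ := by
    have := abs_im_le_norm ((1 + η + 2 * I * t : ℂ) - 1)
    simp [abs_mul] at this
    linarith
  have hne : (1 + η + 2 * I * t : ℂ) ≠ 1 := by
    intro h
    rw [h] at hn1
    norm_num at hn1
  have h1 := norm_riemannZeta_sub_zetaApprox_le hre hne M
  have h2 := norm_zetaApprox_le M hre
  have h3 : ‖(1 + η + 2 * I * t : ℂ)‖ ≤ 2 + 2 * |t| := by
    refine (norm_add_le _ _).trans ?_
    have : ‖(1 + η : ℂ)‖ ≤ 2 := by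
      refine (norm_add_le _ _).trans ?_
      simp [abs_of_nonneg hη]
      linarith
    have h4 : ‖(2 * I * t : ℂ)‖ = 2 * |t| := by simp
    linarith
  have h4 : 1 / ‖(1 + η + 2 * I * t : ℂ) - 1‖ ≤ 1 := by
    rw [div_le_one (by linarith)]
    exact hn1
  have h5 : 2 * ‖(1 + η + 2 * I * t : ℂ)‖ / (M + 1) ≤ 2 := by
    rw [div_le_iff₀ (by positivity)]
    nlinarith
  have h6 := norm_le_norm_add_norm_sub' (riemannZeta (1 + η + 2 * I * t))
    (zetaApprox M (1 + η + 2 * I * t))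
  linarith

lemma norm_riemannZeta_sub_le {t η : ℝ} (ht : 3 ≤ |t|) (hη : 0 ≤ η) (hη1 : η ≤ 1) :
    ‖riemannZeta (1 + η + I * t) - riemannZeta (1 + I * t)‖
      ≤ 16 * η * Real.log |t| ^ 2 + 8 / |t| := by
  obtain ⟨M, hM, hl⟩ := exists_cutoff ht
  have ht0 : t ≠ 0 := by rintro rfl; simp at ht; linarith
  have key : ∀ x : ℝ, 0 ≤ x → x ≤ 1 →
      ‖riemannZeta (1 + x + I * t) - zetaApprox M (1 + x + I * t)‖ ≤ 4 / |t| := by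
    intro x hx hx1
    have hne : (1 + x + I * t : ℂ) ≠ 1 := by
      intro h
      have := congrArg im h
      simp at this
      exact ht0 this
    refine (norm_riemannZeta_sub_zetaApprox_le (by simp [hx]) hne M).trans ?_
    have h3 : ‖(1 + x + I * t : ℂ)‖ ≤ 1 + x + |t| := by
      refine (norm_add_le _ _).trans ?_
      have : ‖(1 + x : ℂ)‖ ≤ 1 + x := by
        refine (norm_add_le _ _).trans ?_
        simp [abs_of_nonneg hx]
      have h4 : ‖(I * t : ℂ)‖ = |t| := by simp
      linarith
    rw [div_le_div_iff₀ (by positivity) (by linarith)]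
    nlinarith
  have k1 := key η hη hη1
  have k2 := key 0 le_rfl zero_le_one
  simp only [ofReal_zero, add_zero] at k2
  have k3 := norm_zetaApprox_sub_le M (t := t) (by linarith) hη
  have hl0 : 0 ≤ Real.log (M + 1) := Real.log_nonneg (by linarith [Nat.cast_nonneg (α := ℝ) M])
  have k4 : η * (1 + Real.log (M + 1)) ^ 2 ≤ η * (4 * Real.log |t|) ^ 2 := by gcongr
  have e : riemannZeta (1 + η + I * t) - riemannZeta (1 + I * t)
      = (riemannZeta (1 + η + I * t) - zetaApprox M (1 + η + I * t))
        + (zetaApprox M (1 + η + I * t) - zetaApprox M (1 + I * t))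
        - (riemannZeta (1 + I * t) - zetaApprox M (1 + I * t)) := by ring
  rw [e]
  have n1 := norm_sub_le ((riemannZeta (1 + η + I * t) - zetaApprox M (1 + η + I * t))
        + (zetaApprox M (1 + η + I * t) - zetaApprox M (1 + I * t)))
        (riemannZeta (1 + I * t) - zetaApprox M (1 + I * t))
  have n2 := norm_add_le (riemannZeta (1 + η + I * t) - zetaApprox M (1 + η + I * t))
        (zetaApprox M (1 + η + I * t) - zetaApprox M (1 + I * t))
  have e8 : 8 / |t| = 4 / |t| + 4 / |t| := by ring
  nlinarith

lemma one_le_norm_riemannZeta_product {η : ℝ} (hη : 0 < η) (t : ℝ) :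
    1 ≤ ‖riemannZeta (1 + η)‖ ^ 3 * ‖riemannZeta (1 + η + I * t)‖ ^ 4
      * ‖riemannZeta (1 + η + 2 * I * t)‖ := by
  have h := DirichletCharacter.norm_LFunction_product_ge_one (1 : DirichletCharacter ℂ 1) hη t
  simpa [DirichletCharacter.LFunctionTrivChar, norm_mul, norm_pow] using h

/-- The lower bound just to the right of the line `Re s = 1` at distance
`(1/200)⁴ / (log |t|)⁹`. -/
lemma le_norm_riemannZeta_right {t : ℝ} (ht : 3 ≤ |t|) :
    (1 / 200) ^ 3 / 6 / Real.log |t| ^ 7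
      ≤ ‖riemannZeta (1 + ((1 / 200) ^ 4 / Real.log |t| ^ 9 : ℝ) + I * t)‖ := by
  have hL : 1 ≤ Real.log |t| := by
    rw [Real.le_log_iff_exp_le (by linarith)]
    linarith [Real.exp_one_lt_d9]
  set L := Real.log |t| with hLdef
  have hL0 : 0 < L := by linarith
  set η : ℝ := (1 / 200) ^ 4 / L ^ 9 with hηdef
  have hη : 0 < η := by positivity
  have hη1 : η ≤ 1 := by
    rw [hηdef, div_le_one (by positivity)]
    exact le_trans (by norm_num) (one_le_pow₀ hL)
  have h1 := one_le_norm_riemannZeta_product hη t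
  have h2 := norm_riemannZeta_one_add_le hη hη1
  have h3 := norm_riemannZeta_le_mul_log ht hη.le hη1
  set z := ‖riemannZeta (1 + η + I * t)‖ with hz
  have hz0 : 0 ≤ z := norm_nonneg _
  have h4 : 1 ≤ (5 / η) ^ 3 * z ^ 4 * (7 * L) := h1.trans (by gcongr)
  by_contra! hlt
  have h5 : z ^ 4 < ((1 / 200) ^ 3 / 6 / L ^ 7) ^ 4 := by gcongr
  have h6 : (5 / η) ^ 3 * z ^ 4 * (7 * L)
      < (5 / η) ^ 3 * ((1 / 200) ^ 3 / 6 / L ^ 7) ^ 4 * (7 * L) := by gcongr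
  have h7 : (5 / η) ^ 3 * ((1 / 200) ^ 3 / 6 / L ^ 7) ^ 4 * (7 * L) = 875 / 1296 := by
    rw [hηdef]
    field_simp
    norm_num
  rw [h7] at h6
  norm_num at h6
  linarith

lemma exists_le_norm_riemannZeta_one_add :
    ∃ c > 0, ∃ T₀ : ℝ, ∀ t : ℝ, T₀ ≤ |t| →
      c / Real.log |t| ^ 7 ≤ ‖riemannZeta (1 + I * t)‖ := by
  have hev : ∀ᶠ T : ℝ in atTop, ‖Real.log T ^ 7‖ ≤ ((1 / 200) ^ 3 / 800) * ‖id T‖ :=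
    Real.isLittleO_pow_log_id_atTop.bound (by norm_num)
  obtain ⟨T₁, hT₁⟩ := eventually_atTop.1 hev
  refine ⟨(1 / 200) ^ 3 / 20, by norm_num, max T₁ 3, fun t ht => ?_⟩
  have ht3 : 3 ≤ |t| := (le_max_right _ _).trans ht
  have h0 := hT₁ |t| ((le_max_left _ _).trans ht)
  have hL : 1 ≤ Real.log |t| := by
    rw [Real.le_log_iff_exp_le (by linarith)]
    linarith [Real.exp_one_lt_d9]
  have h1 := le_norm_riemannZeta_right ht3
  set L := Real.log |t| with hLdef
  have hL0 : 0 < L := by linarith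
  have hη1 : (1 / 200) ^ 4 / L ^ 9 ≤ 1 := by
    rw [div_le_one (by positivity)]
    exact le_trans (by norm_num) (one_le_pow₀ hL)
  have h2 := norm_riemannZeta_sub_le ht3 (η := (1 / 200) ^ 4 / L ^ 9) (by positivity) hη1
  have h3 : 8 / |t| ≤ (1 / 200) ^ 3 / 100 / L ^ 7 := by
    rw [Real.norm_of_nonneg (by positivity), id, Real.norm_of_nonneg (by positivity)] at h0
    rw [div_le_div_iff₀ (by linarith) (by positivity)]
    linarith
  have h4 : 16 * ((1 / 200) ^ 4 / L ^ 9) * L ^ 2 = 8 / 100 * (1 / 200) ^ 3 / L ^ 7 := by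
    field_simp
    norm_num
  rw [← hLdef, h4] at h2
  have h5 := norm_le_norm_add_norm_sub' (riemannZeta (1 + ((1 / 200) ^ 4 / L ^ 9 : ℝ) + I * t))
    (riemannZeta (1 + I * t))
  have h6 : 0 < 1 / L ^ 7 := by positivity
  have e1 : (1 / 200) ^ 3 / 6 / L ^ 7 = (1 / 200) ^ 3 / 6 * (1 / L ^ 7) := by ring
  have e2 : (1 / 200) ^ 3 / 20 / L ^ 7 = (1 / 200) ^ 3 / 20 * (1 / L ^ 7) := by ring
  have e3 : (1 / 200) ^ 3 / 100 / L ^ 7 = (1 / 200) ^ 3 / 100 * (1 / L ^ 7) := by ring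
  have e4 : 8 / 100 * (1 / 200) ^ 3 / L ^ 7 = 8 / 100 * (1 / 200) ^ 3 * (1 / L ^ 7) := by ring
  rw [e1] at h1
  rw [e3] at h3
  rw [e4] at h2
  rw [e2]
  nlinarith

lemma exists_rpow_neg_le_norm_riemannZeta_one_add {ε : ℝ} (hε : 0 < ε) :
    ∃ c > 0, ∀ t : ℝ, 2 ≤ |t| → c * |t| ^ (-ε) ≤ ‖riemannZeta (1 + I * t)‖ := by
  obtain ⟨c, hc, T₀, hT₀⟩ := exists_le_norm_riemannZeta_one_add
  have hev : ∀ᶠ T : ℝ in atTop, ‖Real.log T ^ (7 : ℝ)‖ ≤ 1 * ‖T ^ ε‖ :=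
    (isLittleO_log_rpow_rpow_atTop 7 hε).bound one_pos
  obtain ⟨T₁, hT₁⟩ := eventually_atTop.1 hev
  set T := max T₀ (max T₁ 2) with hT
  have hK : IsCompact ({t : ℝ | 2 ≤ |t|} ∩ Set.Icc (-T) T) :=
    isCompact_Icc.inter_left (isClosed_le continuous_const continuous_abs)
  have hne : ∀ t : ℝ, 2 ≤ |t| → (1 + I * t : ℂ) ≠ 1 := by
    intro t ht h
    have := congrArg im h
    simp at this
    rw [this] at ht
    norm_num at ht
  have hcont : ContinuousOn (fun t : ℝ => ‖riemannZeta (1 + I * t)‖)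
      ({t : ℝ | 2 ≤ |t|} ∩ Set.Icc (-T) T) := by
    intro t ht
    have h1 := (differentiableAt_riemannZeta (hne t ht.1)).continuousAt
    have h2 : ContinuousAt (fun t : ℝ => (1 + I * t : ℂ)) t := by fun_prop
    exact (ContinuousAt.comp (f := fun t : ℝ => (1 + I * t : ℂ)) h1 h2).norm.continuousWithinAt
  have h2T : 2 ≤ T := (le_max_right _ _).trans (le_max_right _ _)
  obtain ⟨t₀, ht₀, hmin⟩ := hK.exists_isMinOn
    ⟨2, by simp, by linarith, h2T⟩ hcont
  set m := ‖riemannZeta (1 + I * t₀)‖ with hm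
  have hm0 : 0 < m := norm_pos_iff.2 (riemannZeta_ne_zero_of_one_le_re (by simp))
  refine ⟨min c m, lt_min hc hm0, fun t ht => ?_⟩
  rcases le_total |t| T with h | h
  · have h1 : m ≤ ‖riemannZeta (1 + I * t)‖ := hmin ⟨ht, abs_le.1 h⟩
    have h2 : |t| ^ (-ε) ≤ 1 :=
      Real.rpow_le_one_of_one_le_of_nonpos (by linarith) (by linarith)
    refine le_trans ?_ h1
    exact (mul_le_of_le_one_right (by positivity) h2).trans (min_le_right _ _)
  · have h1 := hT₀ t ((le_max_left _ _).trans h)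
    have h2 := hT₁ |t| ((le_max_left _ _).trans ((le_max_right _ _).trans h))
    have hL0 : 0 < Real.log |t| := Real.log_pos (by linarith)
    rw [Real.norm_of_nonneg (by positivity), Real.norm_of_nonneg (by positivity), one_mul,
      Real.rpow_ofNat] at h2
    refine le_trans ?_ h1
    rw [Real.rpow_neg (by positivity), ← div_eq_mul_inv]
    gcongr
    exact min_le_left _ _

lemma norm_Gamma_one_sub_I_mul_sq {t : ℝ} (ht : t ≠ 0) :
    ‖Gamma (1 - I * t)‖ ^ 2 = Real.pi * t / Real.sinh (Real.pi * t) := by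
  have hIt : I * (t : ℂ) ≠ 0 := by simp [ht]
  have h1 : (starRingEnd ℂ) (1 - I * (t : ℂ)) = I * t + 1 := by simp; ring
  have h2 : ((‖Gamma (1 - I * t)‖ ^ 2 : ℝ) : ℂ) = Gamma (1 - I * t) * Gamma (I * t + 1) := by
    rw [← h1, Gamma_conj, mul_conj, normSq_eq_norm_sq]
  have hs : Complex.sin (Real.pi * (I * t)) = Complex.sinh (Real.pi * t) * I := by
    rw [← Complex.sin_mul_I]; ring_nf
  have h3 : ((‖Gamma (1 - I * t)‖ ^ 2 : ℝ) : ℂ)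
      = ((Real.pi * t / Real.sinh (Real.pi * t) : ℝ) : ℂ) := by
    rw [h2, Gamma_add_one _ hIt, mul_left_comm, mul_comm (Gamma (1 - I * t)),
      Gamma_mul_Gamma_one_sub, hs]
    push_cast
    field_simp
  exact_mod_cast h3

/-- The functional equation on the imaginary axis. -/
lemma abs_mul_norm_riemannZeta_sq_le {t : ℝ} (ht : 2 ≤ |t|) :
    |t| / (4 * Real.pi) * ‖riemannZeta (1 - I * t)‖ ^ 2 ≤ ‖riemannZeta (I * t)‖ ^ 2 := by
  have ht0 : t ≠ 0 := by rintro rfl; norm_num at ht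
  have hfe := riemannZeta_one_sub (s := 1 - I * t)
    (fun n h => by
      have := congrArg im h
      simp at this
      exact ht0 this)
    (fun h => by
      have := congrArg im h
      simp at this
      exact ht0 this)
  rw [sub_sub_cancel] at hfe
  have hcos : Complex.cos (Real.pi * (1 - I * t) / 2) = Complex.sinh ((Real.pi * t / 2 : ℝ)) * I := by
    rw [← Complex.sin_mul_I, ← Complex.cos_pi_div_two_sub]
    congr 1
    push_cast
    ring
  have hpow : ‖(2 * (Real.pi : ℂ)) ^ (-(1 - I * (t : ℂ)))‖ = (2 * Real.pi)⁻¹ := by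
    have : (2 * (Real.pi : ℂ)) = ((2 * Real.pi : ℝ) : ℂ) := by push_cast; rfl
    rw [this, norm_cpow_eq_rpow_re_of_pos (by positivity), ← Real.rpow_neg_one]
    simp
  have hnorm : ‖riemannZeta (I * t)‖ ^ 2 = 4 * ((2 * Real.pi)⁻¹) ^ 2
      * (Real.pi * t / Real.sinh (Real.pi * t)) * Real.sinh (Real.pi * t / 2) ^ 2
      * ‖riemannZeta (1 - I * t)‖ ^ 2 := by
    rw [hfe, hcos, norm_mul, norm_mul, norm_mul, norm_mul, hpow, mul_pow, mul_pow, mul_pow,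
      mul_pow, norm_Gamma_one_sub_I_mul_sq ht0, norm_mul, ← ofReal_sinh, norm_real,
      norm_I, mul_one, Real.norm_eq_abs, sq_abs, Complex.norm_ofNat]
    norm_num
  rw [hnorm]
  refine mul_le_mul_of_nonneg_right ?_ (by positivity)
  have hpi := Real.pi_gt_three
  have habs : t / Real.sinh (Real.pi * t) * Real.sinh (Real.pi * t / 2) ^ 2
      = |t| / Real.sinh (Real.pi * |t|) * Real.sinh (Real.pi * |t| / 2) ^ 2 := by
    rcases abs_cases t with ⟨h, _⟩ | ⟨h, _⟩ <;> rw [h]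
    rw [mul_neg, Real.sinh_neg, neg_div_neg_eq, neg_div, Real.sinh_neg, neg_sq]
  set x := Real.pi * |t| / 2 with hx
  have hx1 : 1 ≤ x := by rw [hx]; nlinarith
  have hs1 : 1 ≤ Real.sinh x := hx1.trans (Real.self_le_sinh_iff.2 (by linarith))
  have hc1 : Real.cosh x ≤ 2 * Real.sinh x := by
    nlinarith [Real.cosh_sq x, Real.cosh_pos x]
  have hc0 := Real.cosh_pos x
  have hd : Real.sinh (Real.pi * |t|) = 2 * Real.sinh x * Real.cosh x := by
    rw [← Real.sinh_two_mul, hx]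
    congr 1
    ring
  have hkey : |t| / 4 ≤ t / Real.sinh (Real.pi * t) * Real.sinh (Real.pi * t / 2) ^ 2 := by
    rw [habs, hd, div_mul_eq_mul_div, div_le_div_iff₀ (by norm_num) (by positivity)]
    have : |t| * (2 * Real.sinh x * Real.cosh x) ≤ |t| * (2 * Real.sinh x * (2 * Real.sinh x)) := by
      gcongr
    linarith
  calc |t| / (4 * Real.pi) = Real.pi⁻¹ * (|t| / 4) := by field_simp
    _ ≤ Real.pi⁻¹ * (t / Real.sinh (Real.pi * t) * Real.sinh (Real.pi * t / 2) ^ 2) := by gcongr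
    _ = _ := by field_simp; norm_num

/-- Under the Riemann Hypothesis, for every `ε > 0` and every real `t`
with `|t| ≥ 2`, one has `1/|ζ(it)| ≪_ε |t|^{ε-1/2}`, i.e.
`|ζ(it)| ≫_ε |t|^{1/2-ε}`. -/
theorem stmt17 (hRH : RiemannHypothesis) (ε : ℝ) (hε : 0 < ε) :
    ∃ c > 0, ∀ t : ℝ, 2 ≤ |t| →
      c * |t| ^ ((1 : ℝ)/2 - ε) ≤ ‖riemannZeta (I * (t : ℂ))‖ := by
  obtain ⟨c, hc, h⟩ := exists_rpow_neg_le_norm_riemannZeta_one_add hε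
  have hpi := Real.pi_pos
  refine ⟨c / √(4 * Real.pi), by positivity, fun t ht => ?_⟩
  have h1 := h (-t) (by simpa using ht)
  rw [abs_neg, ofReal_neg, mul_neg, ← sub_eq_add_neg] at h1
  have h2 := abs_mul_norm_riemannZeta_sq_le ht
  have ht0 : 0 < |t| := by linarith
  refine le_of_sq_le_sq ?_ (norm_nonneg _)
  refine le_trans (le_of_eq ?_) ((mul_le_mul_of_nonneg_left
    (pow_le_pow_left₀ (by positivity) h1 2) (by positivity)).trans h2)
  rw [mul_pow, div_pow, Real.sq_sqrt (by positivity), sub_eq_add_neg, Real.rpow_add ht0, mul_pow,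
    ← Real.sqrt_eq_rpow, Real.sq_sqrt ht0.le]
  ring
end
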